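/- Let d ≥ 2, η ≥ 4, δ = (δ_1,…,δ_d) ∈ ℕ^d, and set d₁ = max{d, η−1} and B_d(η,δ) = d₁↑^{d²+d−1}(d₁^{|δ|}). Then every graded vector space V = ⊕_{i=1}^d V_i of forms in R with dimension vector δ is contained in a K-subalgebra of R generated by an R_η-sequence of homogeneous forms of degrees at most d and of length at most B_d(η,δ). -/

import Mathlib

open MvPolynomial

/-- Knuth's up-arrow `knuth a k b = a ↑^k b`, with `a ↑^1 b = a ^ b`,
`a ↑^(k+1) 1 = a` and `a ↑^(k+1) (b+1) = a ↑^k (a ↑^(k+1) b)`. -/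
def knuth (a : ℕ) : ℕ → ℕ → ℕ
  | 0, b => a ^ b
  | 1, b => a ^ b
  | _+2, 0 => 1
  | _+2, 1 => a
  | k+2, b+2 => knuth a (k+1) (knuth a (k+2) (b+1))
  termination_by k b => (k, b)

/-- A (Noetherian) local ring is regular iff its maximal ideal can be generated by
`ringKrullDim` many elements. -/
def IsRegularLocal (S : Type*) [CommRing S] : Prop :=
  IsNoetherianRing S ∧ IsLocalRing S ∧
    ∃ s : Finset S, (Ideal.span (s : Set S)).IsMaximal ∧
      (s.card : WithBot (WithTop ℕ)) = ringKrullDim S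

/-- Serre's condition `R_η`: the localization at every prime of height at most `η`
is a regular local ring. -/
def SerreReg (η : ℕ) (S : Type*) [CommRing S] : Prop :=
  ∀ p : PrimeSpectrum S, Order.height p ≤ (η : ℕ∞) →
    IsRegularLocal (Localization.AtPrime p.asIdeal)

/-- `y` is an `R_η`-sequence: it generates a proper ideal and the quotient by each
initial segment satisfies Serre's condition `R_η`. -/
def IsSerreSeq (η : ℕ) {S : Type*} [CommRing S] {n : ℕ} (y : Fin n → S) : Prop :=
  Ideal.span (Set.range y) ≠ ⊤ ∧
    ∀ m : ℕ, m ≤ n →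
      SerreReg η (S ⧸ Ideal.span (y '' {j : Fin n | (j : ℕ) < m}))

/-- `a` is a nonzerodivisor modulo `J`. -/
def NZD {A : Type*} [CommRing A] (J : Ideal A) (a : A) : Prop := ∀ x, a * x ∈ J → x ∈ J

/-- `l` is a weakly regular sequence modulo `I`. -/
def RegR {A : Type*} [CommRing A] : Ideal A → List A → Prop
  | _, [] => True
  | I, a :: t => NZD I a ∧ RegR (I ⊔ Ideal.span {a}) t

/-- Adding successively the members of `l` to `I` gives a strict chain of primes. -/
def PrimeChain {A : Type*} [CommRing A] : Ideal A → List A → Prop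
  | I, [] => I.IsPrime
  | I, a :: t => I.IsPrime ∧ a ∉ I ∧ PrimeChain (I ⊔ Ideal.span {a}) t

section Basic
variable {A : Type*} [CommRing A]

theorem mem_sup_span_singleton {I : Ideal A} {a x : A} :
    x ∈ I ⊔ Ideal.span {a} ↔ ∃ t, x - a * t ∈ I := by
  constructor
  · intro h
    obtain ⟨y, hy, z, hz, rfl⟩ := Submodule.mem_sup.1 h
    obtain ⟨t, rfl⟩ := Ideal.mem_span_singleton'.1 hz
    exact ⟨t, by ring_nf; exact hy⟩
  · rintro ⟨t, ht⟩
    rw [show x = (x - a * t) + t * a by ring]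
    exact Submodule.add_mem_sup ht (Ideal.mem_span_singleton'.2 ⟨t, rfl⟩)

theorem sup_ofList_cons (I : Ideal A) (a : A) (t : List A) :
    I ⊔ Ideal.ofList (a :: t) = I ⊔ Ideal.span {a} ⊔ Ideal.ofList t := by
  rw [Ideal.ofList_cons, sup_assoc]

theorem PrimeChain.prime {I : Ideal A} {l : List A} (h : PrimeChain I l) : I.IsPrime := by
  cases l with
  | nil => exact h
  | cons a t => exact h.1

theorem NZD.of_prime {I : Ideal A} (hI : I.IsPrime) {a : A} (ha : a ∉ I) : NZD I a :=
  fun _ hx => (hI.mem_or_mem hx).resolve_left ha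

theorem PrimeChain.regR {I : Ideal A} {l : List A} (h : PrimeChain I l) : RegR I l := by
  induction l generalizing I with
  | nil => trivial
  | cons a t ih => exact ⟨NZD.of_prime h.1 h.2.1, ih h.2.2⟩

theorem PrimeChain.append {I : Ideal A} {l l' : List A} (h : PrimeChain I (l ++ l')) :
    PrimeChain I l ∧ PrimeChain (I ⊔ Ideal.ofList l) l' := by
  induction l generalizing I with
  | nil => exact ⟨h.prime, by simpa using h⟩
  | cons a t ih =>
    rw [sup_ofList_cons]
    exact ⟨⟨h.1, h.2.1, (ih h.2.2).1⟩, (ih h.2.2).2⟩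

theorem RegR.append_iff {I : Ideal A} {l l' : List A} :
    RegR I (l ++ l') ↔ RegR I l ∧ RegR (I ⊔ Ideal.ofList l) l' := by
  induction l generalizing I with
  | nil => simp [RegR]
  | cons a t ih =>
    rw [sup_ofList_cons]
    simp only [List.cons_append, RegR, ih, and_assoc]

theorem exists_ltSeries_last_eq_maximal [IsLocalRing A] (s : LTSeries (PrimeSpectrum A)) :
    ∃ s' : LTSeries (PrimeSpectrum A), s'.head = s.head ∧
      s'.last.asIdeal = IsLocalRing.maximalIdeal A ∧ s.length ≤ s'.length := by
  by_cases hlast : s.last.asIdeal = IsLocalRing.maximalIdeal A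
  · exact ⟨s, rfl, hlast, le_rfl⟩
  · have h : s.last < (⟨IsLocalRing.maximalIdeal A, inferInstance⟩ : PrimeSpectrum A) :=
      lt_of_le_of_ne (show s.last.asIdeal ≤ _ from IsLocalRing.le_maximalIdeal s.last.2.ne_top)
        (fun h => hlast (by rw [h]))
    exact ⟨s.snoc _ h, by simp, by simp, by simp⟩

theorem length_le_of_sup_ofList_eq_maximal [IsNoetherianRing A] [IsLocalRing A] (l : List A)
    (s : LTSeries (PrimeSpectrum A))
    (hl : s.head.asIdeal ⊔ Ideal.ofList l = IsLocalRing.maximalIdeal A) : s.length ≤ l.length := by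
  induction l generalizing s with
  | nil =>
    by_contra hs
    simp at hl hs
    have h1 : s.head < s ⟨1, by omega⟩ := s.strictMono (by
      rw [Fin.lt_def]; simp)
    have h2 : s.head.asIdeal < (s ⟨1, by omega⟩).asIdeal := h1
    rw [hl] at h2
    exact absurd (IsLocalRing.le_maximalIdeal (s ⟨1, by omega⟩).2.ne_top) (not_le_of_gt h2)
  | cons a t ih =>
    rcases Nat.eq_zero_or_pos s.length with h0 | h0
    · omega
    obtain ⟨s', hs'h, hs'l, hs'len⟩ := exists_ltSeries_last_eq_maximal s
    have ha : a ∈ s'.last.asIdeal := by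
      rw [hs'l, ← hl, Ideal.ofList_cons]
      exact Ideal.mem_sup_right (Ideal.mem_sup_left (Ideal.mem_span_singleton_self a))
    obtain ⟨q, hq1, hq2, hq3, hq4⟩ := PrimeSpectrum.exist_ltSeries_mem_one_of_mem_last s' ha
    have hq0 : q.length ≠ 0 := by omega
    have hth : (q.tail hq0).head = q 1 := by simp
    have h3 : (q.tail hq0).length = q.length - 1 := rfl
    have := ih (q.tail hq0) (by
      rw [hth]
      apply le_antisymm
      · refine sup_le (IsLocalRing.le_maximalIdeal (q 1).2.ne_top) ?_
        rw [← hl, Ideal.ofList_cons]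
        exact le_sup_of_le_right le_sup_right
      · rw [← hl, ← hs'h, hq3, Ideal.ofList_cons, ← sup_assoc]
        refine sup_le_sup_right (sup_le ?_ ?_) _
        · have : q.head ≤ q 1 := q.strictMono.monotone (Fin.zero_le _)
          exact this
        · rwa [Ideal.span_singleton_le_iff_mem])
    simp
    omega

theorem primeChain_aux [IsNoetherianRing A] [IsLocalRing A] (l : List A) (I : Ideal A)
    (s : LTSeries (PrimeSpectrum A)) (hI : I ≤ s.head.asIdeal)
    (hl : I ⊔ Ideal.ofList l = IsLocalRing.maximalIdeal A) (hs : l.length ≤ s.length) :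
    s.head.asIdeal = I ∧ PrimeChain I l := by
  induction l generalizing I s with
  | nil =>
    simp at hl
    have : s.head.asIdeal = I :=
      le_antisymm (hl ▸ IsLocalRing.le_maximalIdeal s.head.2.ne_top) hI
    exact ⟨this, this ▸ s.head.2⟩
  | cons a t ih =>
    obtain ⟨s', hs'h, hs'l, hs'len⟩ := exists_ltSeries_last_eq_maximal s
    have ham : a ∈ IsLocalRing.maximalIdeal A := by
      rw [← hl, Ideal.ofList_cons]
      exact Ideal.mem_sup_right (Ideal.mem_sup_left (Ideal.mem_span_singleton_self a))
    obtain ⟨q, hq1, hq2, hq3, hq4⟩ :=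
      PrimeSpectrum.exist_ltSeries_mem_one_of_mem_last s' (x := a) (by rwa [hs'l])
    simp at hs
    have hq0 : q.length ≠ 0 := by omega
    have hth : (q.tail hq0).head = q 1 := by simp
    have h3 : (q.tail hq0).length = q.length - 1 := rfl
    have hhq : s.head.asIdeal ≤ (q 1).asIdeal := by
      rw [← hs'h, hq3]
      have : q.head ≤ q 1 := q.strictMono.monotone (Fin.zero_le _)
      exact this
    have h1 := ih (I ⊔ Ideal.span {a}) (q.tail hq0) (by
        rw [hth]
        exact sup_le (hI.trans hhq) (by rwa [Ideal.span_singleton_le_iff_mem]))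
      (by rw [← hl, sup_ofList_cons]) (by omega)
    rw [hth] at h1
    have hna : a ∉ s.head.asIdeal := by
      intro ha
      have := length_le_of_sup_ofList_eq_maximal t s (by
        apply le_antisymm
        · refine sup_le (IsLocalRing.le_maximalIdeal s.head.2.ne_top) ?_
          rw [← hl, Ideal.ofList_cons]
          exact le_sup_of_le_right le_sup_right
        · rw [← hl, sup_ofList_cons]
          refine sup_le_sup_right (sup_le hI ?_) _
          rwa [Ideal.span_singleton_le_iff_mem])
      omega
    have hq : s.head.asIdeal = I := by
      refine le_antisymm ?_ hI
      refine Submodule.le_of_le_smul_of_le_jacobson_bot (I := IsLocalRing.maximalIdeal A)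
        (IsNoetherian.noetherian _) (IsLocalRing.maximalIdeal_le_jacobson _) ?_
      intro x hx
      have hx1 : x ∈ I ⊔ Ideal.span {a} := h1.1 ▸ hhq hx
      obtain ⟨t, ht⟩ := mem_sup_span_singleton.1 hx1
      have : a * t ∈ s.head.asIdeal := by
        have := sub_mem hx (hI ht)
        simpa using this
      have := (s.head.2.mem_or_mem this).resolve_left hna
      rw [show x = (x - a * t) + a * t by ring]
      exact Submodule.add_mem_sup ht (Submodule.smul_mem_smul ham this)
    exact ⟨hq, hq ▸ s.head.2, hq ▸ hna, h1.2⟩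

theorem primeChain_of_ofList_eq_maximal [IsNoetherianRing A] [IsLocalRing A] (l : List A)
    (hl : Ideal.ofList l = IsLocalRing.maximalIdeal A) (hs : (l.length : WithBot ℕ∞) ≤ ringKrullDim A) :
    PrimeChain ⊥ l := by
  obtain ⟨s, hs⟩ := Order.le_krullDim_iff.1 (by exact_mod_cast hs :
    ((l.length : ℕ) : WithBot ℕ∞) ≤ Order.krullDim (PrimeSpectrum A))
  exact (primeChain_aux l ⊥ s bot_le (by simpa using hl) hs.ge).2

theorem exists_list_of_linearIndependent_cotangent [IsRegularLocalRing A] {k : ℕ}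
    (v : Fin k → IsLocalRing.maximalIdeal A)
    (hv : LinearIndependent (IsLocalRing.ResidueField A)
      (fun i => (IsLocalRing.maximalIdeal A).toCotangent (v i))) :
    ∃ w : List A, Ideal.ofList (List.ofFn (fun i => (v i : A)) ++ w) = IsLocalRing.maximalIdeal A ∧
      ((k + w.length : ℕ) : WithBot ℕ∞) = ringKrullDim A := by
  classical
  let b := Module.Basis.sumExtend hv
  have : Finite (Fin k ⊕ Module.Basis.sumExtendIndex hv) := Module.Finite.finite_basis b
  have : Finite (Module.Basis.sumExtendIndex hv) :=
    Finite.of_injective (Sum.inr (α := Fin k)) Sum.inr_injective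
  have := Fintype.ofFinite (Module.Basis.sumExtendIndex hv)
  have hsurj : Function.Surjective (IsLocalRing.maximalIdeal A).toCotangent :=
    (IsLocalRing.maximalIdeal A).toCotangent_surjective
  choose w hw using fun i : Module.Basis.sumExtendIndex hv => hsurj (b (Sum.inr i))
  have hinl : ∀ i, b (Sum.inl i) = (IsLocalRing.maximalIdeal A).toCotangent (v i) := by
    intro i; simp [b, Module.Basis.sumExtend]; rfl
  have hspan : Submodule.span A (Set.range v ∪ Set.range w) = ⊤ := by
    rw [← IsLocalRing.CotangentSpace.span_image_eq_top_iff, Set.image_union, ← Set.range_comp,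
      ← Set.range_comp]
    rw [← b.span_eq]
    congr 1
    ext x
    simp only [Set.mem_union, Set.mem_range, Function.comp, Sum.exists, hinl, hw]
  refine ⟨(Finset.univ.toList).map (fun i => (w i : A)), ?_, ?_⟩
  · have := congrArg (Submodule.map (IsLocalRing.maximalIdeal A).subtype) hspan
    rw [Submodule.map_span, Submodule.map_subtype_top] at this
    refine Eq.trans ?_ this
    rw [Ideal.ofList, Ideal.span]
    congr 1
    ext x
    simp only [List.mem_append, List.mem_ofFn, Set.mem_ofPred_eq, Set.image_union, Set.mem_union,
      Set.mem_image, Set.mem_range, List.mem_map, Finset.mem_toList, Finset.mem_univ, true_and,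
      Submodule.subtype_apply, exists_exists_eq_and]
  · have h1 := Module.finrank_eq_nat_card_basis b
    rw [Nat.card_sum, Nat.card_fin] at h1
    have h2 := (IsRegularLocalRing.iff_finrank_cotangentSpace A).1 inferInstance
    rw [h1] at h2
    simpa using h2

end Basic

/-- `P` is an associated prime of `A ⧸ J`. -/
def AssocP {A : Type*} [CommRing A] (J P : Ideal A) : Prop :=
  P.IsPrime ∧ ∃ u, ∀ x, x ∈ P ↔ x * u ∈ J

/-- `A ⧸ J` has a nonzero element killed by the maximal ideal. -/
def HasSocle {A : Type*} [CommRing A] [IsLocalRing A] (J : Ideal A) : Prop :=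
  ∃ u, u ∉ J ∧ ∀ m ∈ IsLocalRing.maximalIdeal A, m * u ∈ J

section Assoc
variable {A : Type*} [CommRing A]

theorem AssocP.le {J P : Ideal A} (h : AssocP J P) : J ≤ P := by
  obtain ⟨_, u, hu⟩ := h
  exact fun x hx => (hu x).2 (J.mul_mem_right u hx)

theorem mem_colon_bot_mk_iff {J : Ideal A} {c x : A} :
    c ∈ (⊥ : Submodule A (A ⧸ J)).colon {Ideal.Quotient.mk J x} ↔ c * x ∈ J := by
  rw [Submodule.mem_colon_singleton, Submodule.mem_bot, ← Ideal.Quotient.eq_zero_iff_mem, map_mul]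
  rfl

theorem assocP_iff [IsNoetherianRing A] {J P : Ideal A} :
    AssocP J P ↔ P ∈ associatedPrimes A (A ⧸ J) := by
  rw [AssocP, AssociatedPrimes.mem_iff, isAssociatedPrime_iff]
  refine and_congr_right fun _ => ⟨fun ⟨u, hu⟩ => ⟨Ideal.Quotient.mk J u, ?_⟩, fun ⟨u, hu⟩ => ?_⟩
  · ext x
    rw [mem_colon_bot_mk_iff, hu]
  · obtain ⟨u, rfl⟩ := Ideal.Quotient.mk_surjective u
    exact ⟨u, fun x => by rw [hu, mem_colon_bot_mk_iff]⟩

theorem finite_assocP [IsNoetherianRing A] (J : Ideal A) : {P | AssocP J P}.Finite := by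
  refine (associatedPrimes.finite A (A ⧸ J)).subset fun P hP => assocP_iff.1 hP

theorem exists_assocP [IsNoetherianRing A] {J : Ideal A} {x : A} (hx : x ∉ J) :
    ∃ P, AssocP J P ∧ ∀ c, c * x ∈ J → c ∈ P := by
  obtain ⟨P, hP, hle⟩ := exists_le_isAssociatedPrime_of_isNoetherianRing A
    (Ideal.Quotient.mk J x) (fun h => hx (Ideal.Quotient.eq_zero_iff_mem.1 h))
  exact ⟨P, assocP_iff.2 hP, fun c hc => hle (mem_colon_bot_mk_iff.2 hc)⟩

theorem exists_nzd [IsNoetherianRing A] {I J₁ J₂ : Ideal A}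
    (h : ∀ P, AssocP J₁ P ∨ AssocP J₂ P → ¬ I ≤ P) : ∃ c ∈ I, NZD J₁ c ∧ NZD J₂ c := by
  have hfin : {P | AssocP J₁ P ∨ AssocP J₂ P}.Finite := (finite_assocP J₁).union (finite_assocP J₂)
  have := (Ideal.subset_union_prime_finite hfin (f := id) ⊥ ⊥
    (fun i hi _ _ => by rcases hi with hi | hi <;> exact hi.1) (I := I)).not.2
    (by rintro ⟨P, hP, hle⟩; exact h P hP hle)
  obtain ⟨c, hc, hcn⟩ := Set.not_subset.1 this
  simp only [Set.mem_iUnion, not_exists] at hcn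
  refine ⟨c, hc, fun x hx => ?_, fun x hx => ?_⟩
  · by_contra hxn
    obtain ⟨P, hP, hh⟩ := exists_assocP hxn
    exact hcn P (Or.inl hP) (hh c hx)
  · by_contra hxn
    obtain ⟨P, hP, hh⟩ := exists_assocP hxn
    exact hcn P (Or.inr hP) (hh c hx)

theorem NZD.not_mem_assocP {J P : Ideal A} {a : A} (ha : NZD J a) (hP : AssocP J P) : a ∉ P := by
  obtain ⟨hp, u, hu⟩ := hP
  intro h
  have h1 : u ∈ J := ha u ((hu a).1 h)
  exact hp.ne_top ((Ideal.eq_top_iff_one _).2 ((hu 1).2 (by simpa using h1)))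

theorem NZD.swap [IsNoetherianRing A] [IsLocalRing A] {J : Ideal A} {a c : A}
    (hm : a ∈ IsLocalRing.maximalIdeal A) (ha : NZD J a) (hc : NZD (J ⊔ Ideal.span {a}) c) :
    NZD J c ∧ NZD (J ⊔ Ideal.span {c}) a := by
  have h1 : NZD J c := by
    let N : Ideal A := Submodule.comap (LinearMap.mulLeft A c) J
    have hN : N ≤ J := by
      refine Submodule.le_of_le_smul_of_le_jacobson_bot (I := IsLocalRing.maximalIdeal A)
        (IsNoetherian.noetherian _) (IsLocalRing.maximalIdeal_le_jacobson _) ?_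
      intro x hx
      have hx : c * x ∈ J := hx
      obtain ⟨t, ht⟩ := mem_sup_span_singleton.1 (hc x (Ideal.mem_sup_left hx))
      have h2 : c * t ∈ J := by
        apply ha
        have := sub_mem hx (J.mul_mem_left c ht)
        convert this using 1
        ring
      rw [show x = (x - a * t) + a * t by ring]
      exact Submodule.add_mem_sup ht (Submodule.smul_mem_smul hm (show t ∈ N from h2))
    exact fun x hx => hN hx
  refine ⟨h1, fun x hx => ?_⟩
  obtain ⟨y, hy⟩ := mem_sup_span_singleton.1 hx
  have h2 : c * y ∈ J ⊔ Ideal.span {a} := by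
    refine mem_sup_span_singleton.2 ⟨x, ?_⟩
    have := neg_mem hy
    convert this using 1
    ring
  obtain ⟨z, hz⟩ := mem_sup_span_singleton.1 (hc y h2)
  refine mem_sup_span_singleton.2 ⟨z, ha _ ?_⟩
  have := add_mem hy (J.mul_mem_left c hz)
  convert this using 1
  ring

theorem RegR.move_front [IsNoetherianRing A] [IsLocalRing A] {I : Ideal A} {l : List A} {c : A}
    (hl : ∀ a ∈ l, a ∈ IsLocalRing.maximalIdeal A) (h : RegR I l)
    (hc : NZD (I ⊔ Ideal.ofList l) c) : NZD I c ∧ RegR (I ⊔ Ideal.span {c}) l := by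
  induction l generalizing I with
  | nil => exact ⟨by simpa using hc, trivial⟩
  | cons a t ih =>
    rw [sup_ofList_cons] at hc
    obtain ⟨h1, h2⟩ := ih (fun b hb => hl b (List.mem_cons_of_mem _ hb)) h.2 hc
    obtain ⟨h3, h4⟩ := NZD.swap (hl a List.mem_cons_self) h.1 h1
    refine ⟨h3, h4, ?_⟩
    rwa [sup_assoc, sup_comm (Ideal.span {c}), ← sup_assoc]

theorem HasSocle.swap [IsLocalRing A] {J : Ideal A} {a b : A}
    (ha : NZD J a) (hb : NZD J b) (hbm : b ∈ IsLocalRing.maximalIdeal A)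
    (h : HasSocle (J ⊔ Ideal.span {a})) : HasSocle (J ⊔ Ideal.span {b}) := by
  obtain ⟨u, hu, hmu⟩ := h
  obtain ⟨v, hv⟩ := mem_sup_span_singleton.1 (hmu b hbm)
  refine ⟨v, fun hvb => hu ?_, fun m hm => ?_⟩
  · obtain ⟨w, hw⟩ := mem_sup_span_singleton.1 hvb
    refine mem_sup_span_singleton.2 ⟨w, hb _ ?_⟩
    have := add_mem hv (J.mul_mem_left a hw)
    convert this using 1
    ring
  · obtain ⟨t, ht⟩ := mem_sup_span_singleton.1 (hmu m hm)
    refine mem_sup_span_singleton.2 ⟨t, ha _ ?_⟩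
    have := sub_mem (J.mul_mem_left b ht) (J.mul_mem_left m hv)
    convert this using 1
    ring

theorem HasSocle.exchange [IsNoetherianRing A] [IsLocalRing A] {I : Ideal A} (k : ℕ) {l l' : List A}
    (hk : l.length = k) (hk' : l'.length = k)
    (hl : ∀ a ∈ l, a ∈ IsLocalRing.maximalIdeal A) (hl' : ∀ a ∈ l', a ∈ IsLocalRing.maximalIdeal A)
    (h : RegR I l) (h' : RegR I l') (hs : HasSocle (I ⊔ Ideal.ofList l)) :
    HasSocle (I ⊔ Ideal.ofList l') := by
  induction k generalizing I l l' with
  | zero =>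
    rw [List.length_eq_zero_iff] at hk hk'
    subst hk hk'
    exact hs
  | succ k ih =>
    obtain rfl | ⟨t, a, rfl⟩ := l.eq_nil_or_concat
    · simp at hk
    obtain rfl | ⟨t', b, rfl⟩ := l'.eq_nil_or_concat
    · simp at hk'
    rw [List.concat_eq_append] at *
    rw [RegR.append_iff] at h h'
    simp only [List.length_append, List.length_singleton, Nat.add_right_cancel_iff] at hk hk'
    have ham := hl a (by simp)
    have hbm := hl' b (by simp)
    have htm : ∀ x ∈ t, x ∈ IsLocalRing.maximalIdeal A := fun x hx => hl x (by simp [hx])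
    have htm' : ∀ x ∈ t', x ∈ IsLocalRing.maximalIdeal A := fun x hx => hl' x (by simp [hx])
    have ha : NZD (I ⊔ Ideal.ofList t) a := h.2.1
    have hb : NZD (I ⊔ Ideal.ofList t') b := h'.2.1
    obtain ⟨c, hcm, hc, hc'⟩ := exists_nzd (I := IsLocalRing.maximalIdeal A)
      (J₁ := I ⊔ Ideal.ofList t) (J₂ := I ⊔ Ideal.ofList t') (by
        rintro P (hP | hP) hle
        · exact ha.not_mem_assocP hP (hle ham)
        · exact hb.not_mem_assocP hP (hle hbm))
    rw [Ideal.ofList_append, Ideal.ofList_singleton, ← sup_assoc] at hs ⊢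
    refine HasSocle.swap hc' hb hbm ?_
    have h1 := HasSocle.swap ha hc hcm hs
    have e : ∀ J, I ⊔ J ⊔ Ideal.span {c} = I ⊔ Ideal.span {c} ⊔ J := fun J => by
      rw [sup_assoc, sup_comm J, sup_assoc]
    rw [e] at h1 ⊢
    exact ih hk hk' htm htm' (RegR.move_front htm h.1 hc).2 (RegR.move_front htm' h'.1 hc').2 h1

theorem ringKrullDim_le_length_of_hasSocle [IsRegularLocalRing A] {l : List A}
    (hl : ∀ a ∈ l, a ∈ IsLocalRing.maximalIdeal A) (h : RegR ⊥ l) (hs : HasSocle (Ideal.ofList l)) :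
    ringKrullDim A ≤ l.length := by
  obtain ⟨w, hw, hwd⟩ := exists_list_of_linearIndependent_cotangent (A := A) (k := 0) (Fin.elim0)
    (by exact linearIndependent_empty_type)
  simp only [List.ofFn_zero, List.nil_append, zero_add] at hw hwd
  rw [← hwd]
  by_contra hlt
  have hlt : l.length < w.length := by
    rw [not_le] at hlt
    exact_mod_cast hlt
  have hc := primeChain_of_ofList_eq_maximal w hw hwd.le
  have hwm : ∀ a ∈ w, a ∈ IsLocalRing.maximalIdeal A := fun a ha => by
    rw [← hw]; exact Ideal.subset_span ha
  rw [← List.take_append_drop l.length w] at hc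
  obtain ⟨h1, h2⟩ := hc.append
  have hs' := HasSocle.exchange (I := ⊥) l.length rfl (l' := w.take l.length) (by simp; omega) hl
    (fun a ha => hwm a (List.mem_of_mem_take ha)) h h1.regR (by simpa using hs)
  rw [List.drop_eq_getElem_cons hlt] at h2
  obtain ⟨h3, h4, _⟩ := h2
  obtain ⟨u, hu, hmu⟩ := hs'
  exact hu ((h3.mem_or_mem (hmu _ (hwm _ (List.getElem_mem hlt)))).resolve_left h4)

end Assoc

section Loc
variable {A : Type*} [CommRing A] (P : Ideal A) [P.IsPrime]

theorem algebraMap_mem_map_iff {J : Ideal A} {x : A} :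
    algebraMap A (Localization.AtPrime P) x ∈ J.map (algebraMap A (Localization.AtPrime P)) ↔
      ∃ s, s ∉ P ∧ s * x ∈ J := by
  rw [IsLocalization.algebraMap_mem_map_algebraMap_iff P.primeCompl]
  simp [Ideal.primeCompl, Submonoid.mem_mk]

theorem mk'_mem_map_iff {J : Ideal A} {x : A} {s : P.primeCompl} :
    IsLocalization.mk' (Localization.AtPrime P) x s ∈ J.map (algebraMap A (Localization.AtPrime P)) ↔
      ∃ s, s ∉ P ∧ s * x ∈ J := by
  rw [← algebraMap_mem_map_iff, ← IsLocalization.mk'_spec (Localization.AtPrime P) x s]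
  refine ⟨fun h => Ideal.mul_mem_right _ _ h, fun h => ?_⟩
  exact (Ideal.mul_unit_mem_iff_mem _ (IsLocalization.map_units _ s)).1 h

theorem NZD.localize {J : Ideal A} {a : A} (h : NZD J a) :
    NZD (J.map (algebraMap A (Localization.AtPrime P))) (algebraMap A _ a) := by
  intro x hx
  obtain ⟨x, s, rfl⟩ := IsLocalization.exists_mk'_eq P.primeCompl x
  rw [IsLocalization.mul_mk'_eq_mk'_of_mul, mk'_mem_map_iff] at hx
  obtain ⟨t, ht, htx⟩ := hx
  refine (mk'_mem_map_iff P).2 ⟨t, ht, h _ ?_⟩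
  rwa [mul_left_comm] at htx

theorem RegR.localize {J : Ideal A} {l : List A} (h : RegR J l) :
    RegR (J.map (algebraMap A (Localization.AtPrime P))) (l.map (algebraMap A _)) := by
  induction l generalizing J with
  | nil => trivial
  | cons a t ih =>
    refine ⟨h.1.localize P, ?_⟩
    have := ih h.2
    rwa [Ideal.map_sup, Ideal.map_span, Set.image_singleton] at this

/-- Unmixedness: a regular ring is Cohen-Macaulay. -/
theorem height_le_of_assocP [IsRegularRing A] {l : List A} (hl : RegR ⊥ l)
    (hP : AssocP (Ideal.ofList l) P) : P.height ≤ l.length := by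
  have hreg : IsRegularLocalRing (Localization.AtPrime P) := inferInstance
  have hle := hP.le
  obtain ⟨hp, u, hu⟩ := hP
  have := ringKrullDim_le_length_of_hasSocle (l := l.map (algebraMap A (Localization.AtPrime P)))
    (fun a ha => by
      obtain ⟨b, hb, rfl⟩ := List.mem_map.1 ha
      exact (IsLocalization.AtPrime.to_map_mem_maximal_iff _ P b).2 (hle (Ideal.subset_span hb)))
    (by simpa using hl.localize P) (by
      rw [← Ideal.map_ofList]
      refine ⟨algebraMap A _ u, fun h => ?_, fun m hm => ?_⟩
      · obtain ⟨s, hs, hsu⟩ := (algebraMap_mem_map_iff P).1 h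
        exact hs ((hu s).2 hsu)
      · obtain ⟨x, s, rfl⟩ := IsLocalization.exists_mk'_eq P.primeCompl m
        rw [IsLocalization.AtPrime.mk'_mem_maximal_iff _ P] at hm
        rw [mul_comm, IsLocalization.mul_mk'_eq_mk'_of_mul, mk'_mem_map_iff]
        exact ⟨1, P.ne_top_iff_one.1 hp.ne_top, by rw [one_mul, mul_comm]; exact (hu x).1 hm⟩)
  rw [IsLocalization.AtPrime.ringKrullDim_eq_height P] at this
  simp only [List.length_map] at this
  exact_mod_cast this

end Loc

section

variable {K : Type*} [Field K] {N : ℕ}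

/-- The gradients of the `y i` are linearly dependent modulo `P`. -/
def Dep (P : Ideal (MvPolynomial (Fin N) K)) {n : ℕ} (y : Fin n → MvPolynomial (Fin N) K) : Prop :=
  ∃ c : Fin n → MvPolynomial (Fin N) K,
    (∃ i, c i ∉ P) ∧ ∀ j, ∑ i, c i * pderiv j (y i) ∈ P

theorem pderiv_mem_of_mem_sq (P : Ideal (MvPolynomial (Fin N) K)) {f : MvPolynomial (Fin N) K}
    (hf : f ∈ P ^ 2) (j : Fin N) : pderiv j f ∈ P := by
  rw [pow_two] at hf
  induction hf using Submodule.mul_induction_on' with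
  | mem_mul_mem m hm n hn =>
    rw [Derivation.leibniz]
    exact add_mem (P.mul_mem_right _ hm) (P.mul_mem_right _ hn)
  | add x _ y _ hx hy => rw [map_add]; exact add_mem hx hy

theorem linearIndependent_of_not_dep {P : Ideal (MvPolynomial (Fin N) K)} [P.IsPrime] {n : ℕ}
    {y : Fin n → MvPolynomial (Fin N) K} (hy : ∀ i, y i ∈ P) (h : ¬ Dep P y) :
    LinearIndependent (IsLocalRing.ResidueField (Localization.AtPrime P))
      (fun i => (IsLocalRing.maximalIdeal (Localization.AtPrime P)).toCotangent
        ⟨algebraMap _ _ (y i), (IsLocalization.AtPrime.to_map_mem_maximal_iff _ P (y i)).2 (hy i)⟩) := by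
  rw [Fintype.linearIndependent_iff]
  intro g hg
  choose r hr using fun i => IsLocalRing.residue_surjective (g i)
  obtain ⟨⟨s, hs⟩, hb⟩ := IsLocalization.exist_integer_multiples P.primeCompl Finset.univ r
  choose c hc using fun i => hb i (Finset.mem_univ i)
  simp only [Algebra.smul_def] at hc
  have h1 : (∑ i, r i • (⟨algebraMap _ (Localization.AtPrime P) (y i),
      (IsLocalization.AtPrime.to_map_mem_maximal_iff _ P (y i)).2 (hy i)⟩ :
      IsLocalRing.maximalIdeal (Localization.AtPrime P)) :
      IsLocalRing.maximalIdeal (Localization.AtPrime P)).1 ∈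
      (IsLocalRing.maximalIdeal (Localization.AtPrime P)) ^ 2 := by
    rw [← Ideal.toCotangent_eq_zero, map_sum]
    rw [← hg]
    refine Finset.sum_congr rfl fun i _ => ?_
    rw [map_smul, ← hr]
    rfl
  have h2 : algebraMap _ (Localization.AtPrime P) (∑ i, c i * y i) ∈
      (P ^ 2).map (algebraMap _ (Localization.AtPrime P)) := by
    rw [Ideal.map_pow, Localization.AtPrime.map_eq_maximalIdeal, map_sum]
    have := Ideal.mul_mem_left _ (algebraMap _ (Localization.AtPrime P) s) h1
    convert this using 1
    rw [AddSubmonoidClass.coe_finsetSum, Finset.mul_sum]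
    refine Finset.sum_congr rfl fun i _ => ?_
    rw [map_mul, hc]
    simp [mul_assoc]
  obtain ⟨t, ht, htm⟩ := (algebraMap_mem_map_iff P).1 h2
  have hcP : ∀ i, c i ∈ P := by
    by_contra hcon
    push Not at hcon
    refine h ⟨c, hcon, fun j => ?_⟩
    have h3 := pderiv_mem_of_mem_sq P htm j
    have hmem : ∑ i, c i * y i ∈ P := sum_mem fun i _ => P.mul_mem_left _ (hy i)
    rw [Derivation.leibniz] at h3
    have h4 := (P.add_mem_iff_left (P.mul_mem_right _ hmem)).1 h3
    have h5 := (Ideal.IsPrime.mem_or_mem ‹_› h4).resolve_left ht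
    rw [map_sum] at h5
    have h6 : ∑ i, y i * pderiv j (c i) ∈ P := sum_mem fun i _ => P.mul_mem_right _ (hy i)
    have h7 := sub_mem h5 h6
    convert h7 using 1
    rw [← Finset.sum_sub_distrib]
    refine Finset.sum_congr rfl fun i _ => ?_
    rw [Derivation.leibniz]
    simp
  intro i
  rw [← hr, IsLocalRing.residue_eq_zero_iff]
  have h8 : algebraMap _ (Localization.AtPrime P) s * r i ∈
      IsLocalRing.maximalIdeal (Localization.AtPrime P) := by
    rw [← hc]
    exact (IsLocalization.AtPrime.to_map_mem_maximal_iff _ P _).2 (hcP i)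
  exact (Ideal.unit_mul_mem_iff_mem _
    (IsLocalization.map_units (Localization.AtPrime P) (⟨s, hs⟩ : P.primeCompl))).1 h8

theorem exists_parameters_of_not_dep {P : Ideal (MvPolynomial (Fin N) K)} [P.IsPrime] {n : ℕ}
    {y : Fin n → MvPolynomial (Fin N) K} (hy : ∀ i, y i ∈ P) (h : ¬ Dep P y) :
    ∃ w : List (Localization.AtPrime P), (Ideal.span (Set.range y)).map (algebraMap _ (Localization.AtPrime P)) ⊔
        Ideal.ofList w = IsLocalRing.maximalIdeal (Localization.AtPrime P) ∧
      ((Ideal.span (Set.range y)).map (algebraMap _ (Localization.AtPrime P))).IsPrime ∧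
      ((n + w.length : ℕ) : ℕ∞) = P.height := by
  have : IsRegularLocalRing (Localization.AtPrime P) := inferInstance
  obtain ⟨w, hw, hwd⟩ := exists_list_of_linearIndependent_cotangent _ (linearIndependent_of_not_dep hy h)
  have e : Ideal.ofList (List.ofFn fun i => algebraMap _ (Localization.AtPrime P) (y i)) =
      (Ideal.span (Set.range y)).map (algebraMap _ (Localization.AtPrime P)) := by
    rw [Ideal.map_span, Ideal.ofList]
    congr 1
    ext x
    simp
  have hc := primeChain_of_ofList_eq_maximal _ hw (by simp [← hwd])
  refine ⟨w, ?_, ?_, ?_⟩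
  · rw [← hw, Ideal.ofList_append, ← e]
  · have := hc.append.2.prime
    rwa [bot_sup_eq, e] at this
  · rw [IsLocalization.AtPrime.ringKrullDim_eq_height P] at hwd
    exact_mod_cast hwd

theorem length_le_height_of_not_dep {P : Ideal (MvPolynomial (Fin N) K)} [P.IsPrime] {n : ℕ}
    {y : Fin n → MvPolynomial (Fin N) K} (hy : ∀ i, y i ∈ P) (h : ¬ Dep P y) :
    (n : ℕ∞) ≤ P.height := by
  obtain ⟨w, -, -, hw⟩ := exists_parameters_of_not_dep hy h
  rw [← hw]
  exact_mod_cast Nat.le_add_right _ _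

theorem height_comap_mk_le {n : ℕ} {y : Fin n → MvPolynomial (Fin N) K}
    (p : Ideal (MvPolynomial (Fin N) K ⧸ Ideal.span (Set.range y))) [p.IsPrime] :
    (p.comap (Ideal.Quotient.mk (Ideal.span (Set.range y)))).height ≤ p.height + n := by
  have h1 := Ideal.height_le_height_add_encard_of_subset (Set.range y)
    (p := p.comap (Ideal.Quotient.mk (Ideal.span (Set.range y)))) (by
      rintro _ ⟨i, rfl⟩
      have h0 : Ideal.Quotient.mk (Ideal.span (Set.range y)) (y i) = 0 :=
        Ideal.Quotient.eq_zero_iff_mem.2 (Ideal.subset_span ⟨i, rfl⟩)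
      rw [SetLike.mem_coe, Ideal.mem_comap, h0]
      exact p.zero_mem)
  rw [Ideal.map_comap_of_surjective _ Ideal.Quotient.mk_surjective p] at h1
  refine h1.trans (add_le_add_right ?_ _)
  rw [← Set.image_univ]
  refine (Set.encard_image_le _ _).trans ?_
  simp

theorem isRegularLocal_of_not_dep {n : ℕ}
    {y : Fin n → MvPolynomial (Fin N) K}
    (p : Ideal (MvPolynomial (Fin N) K ⧸ Ideal.span (Set.range y))) [p.IsPrime]
    (h : ¬ Dep (p.comap (Ideal.Quotient.mk _)) y) :
    IsRegularLocal (Localization.AtPrime p) := by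
  classical
  set P := p.comap (Ideal.Quotient.mk (Ideal.span (Set.range y))) with hP
  have hy0 : ∀ i, Ideal.Quotient.mk (Ideal.span (Set.range y)) (y i) = 0 := fun i =>
    Ideal.Quotient.eq_zero_iff_mem.2 (Ideal.subset_span ⟨i, rfl⟩)
  have hy : ∀ i, y i ∈ P := fun i => by
    rw [hP, Ideal.mem_comap, hy0]; exact p.zero_mem
  have hmapP : P.map (Ideal.Quotient.mk (Ideal.span (Set.range y))) = p :=
    Ideal.map_comap_of_surjective _ Ideal.Quotient.mk_surjective p
  obtain ⟨w, hw, -, hwd⟩ := exists_parameters_of_not_dep hy h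
  have hht : P.height ≤ p.height + n := height_comap_mk_le p
  let φ := Localization.localRingHom P p (Ideal.Quotient.mk (Ideal.span (Set.range y))) rfl
  refine ⟨inferInstance, inferInstance, (w.map φ).toFinset, ?_⟩
  have hgen : Ideal.span (((w.map φ).toFinset : Finset _) : Set (Localization.AtPrime p)) =
      IsLocalRing.maximalIdeal (Localization.AtPrime p) := by
    have h1 : (IsLocalRing.maximalIdeal (Localization.AtPrime P)).map φ =
        IsLocalRing.maximalIdeal (Localization.AtPrime p) := by
      rw [← Localization.AtPrime.map_eq_maximalIdeal, ← Localization.AtPrime.map_eq_maximalIdeal,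
        Ideal.map_map]
      refine Eq.trans ?_ (congrArg (Ideal.map (algebraMap _ (Localization.AtPrime p))) hmapP)
      rw [Ideal.map_map]
      congr 1
      refine RingHom.ext fun x => ?_
      simp [φ, Localization.localRingHom_to_map]
    rw [← h1, ← hw, Ideal.map_sup, Ideal.map_ofList]
    have h2 : ((Ideal.span (Set.range y)).map (algebraMap _ (Localization.AtPrime P))).map φ = ⊥ := by
      rw [Ideal.map_map, eq_bot_iff, Ideal.map_le_iff_le_comap, Ideal.span_le]
      rintro _ ⟨i, rfl⟩
      simp [φ, Localization.localRingHom_to_map, hy0]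
    rw [h2, bot_sup_eq, Ideal.ofList]
    congr 1
    ext x
    simp
  refine ⟨hgen ▸ inferInstance, ?_⟩
  rw [IsLocalization.AtPrime.ringKrullDim_eq_height p]
  have h3 : ((w.map φ).toFinset.card : ℕ∞) ≤ p.height := by
    have h4 : (w.length : ℕ∞) ≤ p.height := by
      rw [← hwd, add_comm p.height] at hht
      push_cast at hht
      exact (ENat.add_le_add_iff_left (ENat.natCast_ne_top n)).1 hht
    refine le_trans ?_ h4
    have := List.toFinset_card_le (w.map φ)
    rw [List.length_map] at this
    exact_mod_cast this
  have h5 : p.height ≤ ((w.map φ).toFinset.card : ℕ∞) := by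
    have h6 := Ideal.height_le_card_of_mem_minimalPrimes_span_finset
      (p := IsLocalRing.maximalIdeal (Localization.AtPrime p)) (s := (w.map φ).toFinset) (by
        rw [hgen]
        simp [Ideal.minimalPrimes_eq_subsingleton_self])
    have h7 := IsLocalRing.maximalIdeal_height_eq_ringKrullDim (R := Localization.AtPrime p)
    rw [IsLocalization.AtPrime.ringKrullDim_eq_height p] at h7
    rwa [WithBot.coe_inj.1 h7] at h6
  exact congrArg (WithBot.some) (le_antisymm h3 h5)

end

/-- The gradients of the `y i` stay independent outside codimension `n + η`. -/
def SmoothSeq (η : ℕ) {K : Type*} [Field K] {N n : ℕ} (y : Fin n → MvPolynomial (Fin N) K) : Prop :=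
  ∀ P : Ideal (MvPolynomial (Fin N) K), P.IsPrime → Dep P y → ((n + η : ℕ) : ℕ∞) < P.height

section Homog
variable {σ K : Type*} [CommRing K]

theorem homogeneousComponent_mul_of_isHomogeneous (f : MvPolynomial σ K) {g : MvPolynomial σ K} {e : ℕ}
    (hg : g.IsHomogeneous e) (k : ℕ) :
    homogeneousComponent k (f * g) = if e ≤ k then homogeneousComponent (k - e) f * g else 0 := by
  conv_lhs => rw [← sum_homogeneousComponent f]
  rw [Finset.sum_mul, map_sum]
  have h1 : ∀ i, homogeneousComponent k (homogeneousComponent i f * g) =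
      if i + e = k then homogeneousComponent i f * g else 0 := by
    intro i
    rw [homogeneousComponent_of_mem ((homogeneousComponent_isHomogeneous i f).mul hg)]
    simp only [eq_comm]
  simp only [h1]
  split_ifs with h
  · have h2 : ∀ i, i + e = k ↔ i = k - e := fun i => by omega
    simp only [h2, Finset.sum_ite_eq', Finset.mem_range]
    split_ifs with h3
    · rfl
    · rw [homogeneousComponent_eq_zero _ _ (by omega), zero_mul]
  · exact Finset.sum_eq_zero fun i _ => if_neg (by omega)

theorem homogeneousComponent_mem_span {s : Set (MvPolynomial σ K)}
    (hs : ∀ x ∈ s, ∃ e, x.IsHomogeneous e) {f : MvPolynomial σ K} (hf : f ∈ Ideal.span s) (k : ℕ) :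
    homogeneousComponent k f ∈ Ideal.span s :=
  letI : GradedAlgebra (homogeneousSubmodule σ K) := MvPolynomial.gradedAlgebra
  homogeneousComponent_mem_of_mem (Ideal.homogeneous_span _ s hs) hf k

theorem mem_of_homogeneousComponent_mem {I : Ideal (MvPolynomial σ K)} {f : MvPolynomial σ K}
    (h : ∀ k, homogeneousComponent k f ∈ I) : f ∈ I := by
  rw [← sum_homogeneousComponent f]
  exact sum_mem fun i _ => h i

theorem mem_of_mul_mem_of_constantCoeff {K : Type*} [Field K] {I : Ideal (MvPolynomial σ K)}
    (hI : ∀ f ∈ I, ∀ k, homogeneousComponent k f ∈ I) {s f : MvPolynomial σ K}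
    (hs : constantCoeff s ≠ 0) (h : s * f ∈ I) : f ∈ I := by
  refine mem_of_homogeneousComponent_mem fun k => ?_
  induction k using Nat.strong_induction_on with
  | _ k ih =>
    have h1 := hI _ h k
    have h2 : homogeneousComponent k (s * f) =
        ∑ j ∈ Finset.range (f.totalDegree + 1), if j ≤ k then
          homogeneousComponent (k - j) s * homogeneousComponent j f else 0 := by
      conv_lhs => rw [← sum_homogeneousComponent f]
      rw [Finset.mul_sum, map_sum]
      exact Finset.sum_congr rfl fun j _ =>
        homogeneousComponent_mul_of_isHomogeneous _ (homogeneousComponent_isHomogeneous j f) k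
    by_cases hk : k ∈ Finset.range (f.totalDegree + 1)
    · rw [h2, ← Finset.add_sum_erase _ _ hk] at h1
      have h3 : ∑ j ∈ (Finset.range (f.totalDegree + 1)).erase k, (if j ≤ k then
          homogeneousComponent (k - j) s * homogeneousComponent j f else 0) ∈ I := by
        refine sum_mem fun j hj => ?_
        split_ifs with hjk
        · exact I.mul_mem_left _ (ih j (lt_of_le_of_ne hjk (Finset.ne_of_mem_erase hj)))
        · exact I.zero_mem
      have h4 := (I.add_mem_iff_left h3).1 h1
      simp only [le_refl, if_true, Nat.sub_self, homogeneousComponent_zero] at h4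
      have h5 := I.mul_mem_left (C (constantCoeff s)⁻¹) h4
      rwa [← mul_assoc, ← C_mul, ← constantCoeff_eq, inv_mul_cancel₀ hs, C_1, one_mul] at h5
    · rw [homogeneousComponent_eq_zero _ _ (by simp at hk; omega)]
      exact I.zero_mem

end Homog

section Colon
variable {A : Type*} [CommRing A]

/-- If each element of `J` is multiplied into `I` by an element outside `P`, then one element outside
`P` multiplies all of `J` into `I`. -/
theorem exists_mul_mem_of_map_le [IsNoetherianRing A] {P I J : Ideal A} [P.IsPrime]
    (h : ∀ f ∈ J, ∃ s, s ∉ P ∧ s * f ∈ I) : ∃ s, s ∉ P ∧ ∀ f ∈ J, s * f ∈ I := by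
  classical
  obtain ⟨t, rfl⟩ := (IsNoetherian.noetherian J)
  choose! s hs using h
  refine ⟨∏ f ∈ t, s f, fun hmem => ?_, fun f hf => ?_⟩
  · obtain ⟨f, hf, hfP⟩ := (Ideal.IsPrime.prod_mem_iff (p := P)).1 hmem
    exact (hs f (Submodule.subset_span hf)).1 hfP
  · have h1 : Submodule.span A (t : Set A) ≤ Submodule.comap (LinearMap.mulLeft A (∏ f ∈ t, s f)) I := by
      rw [Submodule.span_le]
      intro f hf
      change (∏ f ∈ t, s f) * f ∈ I
      rw [← Finset.mul_prod_erase t s hf]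
      have := I.mul_mem_left (∏ x ∈ t.erase f, s x) (hs f (Submodule.subset_span hf)).2
      convert this using 1
      ring
    exact h1 hf

theorem RegR.snoc {I : Ideal A} {l : List A} {a : A} (h : RegR I l) (ha : NZD (I ⊔ Ideal.ofList l) a) :
    RegR I (l ++ [a]) := RegR.append_iff.2 ⟨h, ha, trivial⟩

end Colon

section

variable {K : Type*} [Field K] {N : ℕ}

theorem isPrime_of_locally_prime {I : Ideal (MvPolynomial (Fin N) K)}
    (hcomp : ∀ f ∈ I, ∀ k, homogeneousComponent k f ∈ I) (hconst : ∀ f ∈ I, constantCoeff f = 0)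
    {l : List (MvPolynomial (Fin N) K)} (hl : RegR ⊥ l) (hIl : Ideal.ofList l = I)
    (hloc : ∀ (P : Ideal (MvPolynomial (Fin N) K)) [P.IsPrime], I ≤ P → P.height ≤ (l.length + 2 : ℕ) →
      (I.map (algebraMap _ (Localization.AtPrime P))).IsPrime) : I.IsPrime := by
  refine ⟨fun h => ?_, fun {f g} hfg => ?_⟩
  · have := hconst 1 (h ▸ Submodule.mem_top)
    simp at this
  by_contra hcon
  push Not at hcon
  obtain ⟨hf, hg⟩ := hcon
  let J₁ : Ideal (MvPolynomial (Fin N) K) := Submodule.comap (LinearMap.mulLeft (MvPolynomial (Fin N) K) g) I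
  have hJ₁ : ∀ x, x ∈ J₁ ↔ g * x ∈ I := fun x => Iff.rfl
  let J₂ : Ideal (MvPolynomial (Fin N) K) :=
    { carrier := {x | ∀ z ∈ J₁, x * z ∈ I}
      add_mem' := fun ha hb z hz => by rw [add_mul]; exact add_mem (ha z hz) (hb z hz)
      zero_mem' := fun z _ => by rw [zero_mul]; exact I.zero_mem
      smul_mem' := fun c x hx z hz => by
        rw [smul_eq_mul, mul_assoc]; exact I.mul_mem_left _ (hx z hz) }
  have hJ₂ : ∀ x, x ∈ J₂ ↔ ∀ z ∈ J₁, x * z ∈ I := fun x => Iff.rfl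
  have hfJ : f ∈ J₁ := by rw [hJ₁, mul_comm]; exact hfg
  have hgJ : g ∈ J₂ := fun z hz => hz
  have hI1 : I ≤ J₁ := fun x hx => I.mul_mem_left _ hx
  -- no prime of small height contains `J₁ ⊔ J₂`
  have key : ∀ P : Ideal (MvPolynomial (Fin N) K), P.IsPrime → P.height ≤ (l.length + 2 : ℕ) →
      ¬ J₁ ⊔ J₂ ≤ P := by
    intro P hP hht hle
    have hpr := hloc P (hI1.trans (le_sup_left.trans hle)) hht
    by_cases hgI : algebraMap _ (Localization.AtPrime P) g ∈ I.map (algebraMap _ (Localization.AtPrime P))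
    · obtain ⟨s, hs, hsg⟩ := (algebraMap_mem_map_iff P).1 hgI
      exact hs (hle (Ideal.mem_sup_left (by rwa [hJ₁, mul_comm])))
    · obtain ⟨s, hs, hsm⟩ := exists_mul_mem_of_map_le (P := P) (I := I) (J := J₁) (fun x hx => by
        rw [← algebraMap_mem_map_iff]
        refine (hpr.mem_or_mem (x := algebraMap _ _ g) ?_).resolve_left hgI
        rw [← map_mul]
        exact Ideal.mem_map_of_mem _ hx)
      exact hs (hle (Ideal.mem_sup_right hsm))
  obtain ⟨a, haJ, ha, -⟩ := exists_nzd (I := J₁ ⊔ J₂) (J₁ := I) (J₂ := I) (by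
    rintro P hP
    rw [or_self, ← hIl] at hP
    have := hP.1
    exact key P hP.1 ((height_le_of_assocP P hl hP).trans (by exact_mod_cast (by omega))))
  have hreg2 : RegR ⊥ (l ++ [a]) := hl.snoc (by rwa [bot_sup_eq, hIl])
  have hIl2 : Ideal.ofList (l ++ [a]) = I ⊔ Ideal.span {a} := by
    rw [Ideal.ofList_append, hIl, Ideal.ofList_singleton]
  obtain ⟨b, hbJ, hb, -⟩ := exists_nzd (I := J₁ ⊔ J₂) (J₁ := I ⊔ Ideal.span {a})
    (J₂ := I ⊔ Ideal.span {a}) (by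
    rintro P hP
    rw [or_self, ← hIl2] at hP
    have := hP.1
    have h1 := height_le_of_assocP P hreg2 hP
    rw [List.length_append, List.length_singleton] at h1
    exact key P hP.1 (h1.trans (by exact_mod_cast (by omega))))
  obtain ⟨a₁, ha₁, a₂, ha₂, rfl⟩ := Submodule.mem_sup.1 haJ
  obtain ⟨b₁, hb₁, b₂, hb₂, rfl⟩ := Submodule.mem_sup.1 hbJ
  -- `J₁ J₂ ⊆ I`
  have h12 : ∀ x ∈ J₂, ∀ z ∈ J₁, x * z ∈ I := fun x hx z hz => hx z hz
  obtain ⟨e, he⟩ := mem_sup_span_singleton.1 (hb a₁ (mem_sup_span_singleton.2 ⟨b₁, by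
    have := sub_mem (h12 _ hb₂ _ ha₁) (h12 _ ha₂ _ hb₁)
    convert this using 1
    ring⟩))
  have hee : e * (1 - e) ∈ I := by
    refine ha _ (ha _ ?_)
    have h1 := h12 _ ha₂ _ ha₁
    have h2 := I.mul_mem_left ((a₁ + a₂) * (1 - e)) he
    have h3 := I.mul_mem_left a₁ he
    have : (a₁ + a₂) * ((a₁ + a₂) * (e * (1 - e))) =
      a₂ * a₁ + a₁ * (a₁ - (a₁ + a₂) * e) - (a₁ + a₂) * (1 - e) * (a₁ - (a₁ + a₂) * e) := by ring
    rw [this]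
    exact sub_mem (add_mem h1 h3) h2
  by_cases hc : constantCoeff e = 0
  · have heI : e ∈ I := mem_of_mul_mem_of_constantCoeff (s := 1 - e) hcomp
      (by rw [map_sub, hc, map_one, sub_zero]; exact one_ne_zero) (by rwa [mul_comm])
    have ha1 : a₁ ∈ I := by
      have := add_mem he (I.mul_mem_left (a₁ + a₂) heI)
      simpa using this
    refine hf (ha _ ?_)
    rw [add_mul]
    exact add_mem (I.mul_mem_right _ ha1) (h12 _ ha₂ _ hfJ)
  · have heI : 1 - e ∈ I := mem_of_mul_mem_of_constantCoeff (s := e) hcomp hc hee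
    have ha2 : a₂ ∈ I := by
      have := sub_mem (I.mul_mem_left (a₁ + a₂) heI) he
      convert this using 1
      ring
    refine hg (ha _ ?_)
    rw [add_mul]
    refine add_mem ?_ (I.mul_mem_right _ ha2)
    rw [mul_comm]
    exact h12 _ hgJ _ ha₁

theorem Dep.of_comp {P : Ideal (MvPolynomial (Fin N) K)} {m n : ℕ}
    {y : Fin n → MvPolynomial (Fin N) K} {f : Fin m → Fin n} (hf : Function.Injective f)
    (h : Dep P (y ∘ f)) : Dep P y := by
  obtain ⟨c, ⟨i, hi⟩, hc⟩ := h
  refine ⟨Function.extend f c 0, ⟨f i, by rwa [hf.extend_apply]⟩, fun j => ?_⟩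
  rw [← Fintype.sum_of_injective f hf (fun i => c i * pderiv j (y (f i)))]
  · exact hc j
  · intro i hi
    rw [Function.extend_apply' _ _ _ (by simpa using hi)]
    simp
  · intro i
    rw [hf.extend_apply]

theorem SmoothSeq.comp {η m n : ℕ} {y : Fin n → MvPolynomial (Fin N) K} (h : SmoothSeq η y)
    {f : Fin m → Fin n} (hf : Function.Injective f) : SmoothSeq η (y ∘ f) := by
  intro P hP hd
  refine lt_of_le_of_lt ?_ (h P hP (hd.of_comp hf))
  have : m ≤ n := by simpa using Fintype.card_le_of_injective f hf
  exact_mod_cast (by omega)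

theorem height_le_of_minimalPrimes_span_range {A : Type*} [CommRing A] [IsNoetherianRing A] {n : ℕ}
    {y : Fin n → A} {P : Ideal A} (hP : P ∈ (Ideal.span (Set.range y)).minimalPrimes) :
    P.height ≤ n := by
  refine (Ideal.height_le_card_of_mem_minimalPrimes_span (Set.finite_range y) hP).trans ?_
  rw [← Set.image_univ]
  have := Set.ncard_image_le (f := y) (Set.finite_univ)
  rw [Set.ncard_univ, Nat.card_fin] at this
  exact_mod_cast this

theorem ofList_ofFn {A : Type*} [CommRing A] {m : ℕ} (z : Fin m → A) :
    Ideal.ofList (List.ofFn z) = Ideal.span (Set.range z) := by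
  rw [Ideal.ofList]
  congr 1
  ext x
  simp

theorem SmoothSeq.prime_of_regR {η : ℕ} (hη : 2 ≤ η) {n : ℕ} {y : Fin n → MvPolynomial (Fin N) K}
    (hom : ∀ i, ∃ e, 0 < e ∧ (y i).IsHomogeneous e) (hs : SmoothSeq η y)
    (hreg : RegR ⊥ (List.ofFn y)) : (Ideal.span (Set.range y)).IsPrime := by
  have hcomp : ∀ f ∈ Ideal.span (Set.range y), ∀ k, homogeneousComponent k f ∈ Ideal.span (Set.range y) :=
    fun f hf k => homogeneousComponent_mem_span
      (by rintro _ ⟨i, rfl⟩; obtain ⟨e, -, he⟩ := hom i; exact ⟨e, he⟩) hf k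
  have hconst : ∀ f ∈ Ideal.span (Set.range y), constantCoeff f = 0 := by
    intro f hf
    have : Ideal.span (Set.range y) ≤ RingHom.ker (constantCoeff (σ := Fin N) (R := K)) := by
      rw [Ideal.span_le]
      rintro _ ⟨i, rfl⟩
      obtain ⟨e, he0, he⟩ := hom i
      change constantCoeff (y i) = 0
      rw [constantCoeff_eq]
      exact he.coeff_eq_zero (by simpa using he0.ne)
    exact this hf
  refine isPrime_of_locally_prime hcomp hconst hreg (ofList_ofFn y) fun P hP hle hht => ?_
  have hnd : ¬ Dep P y := fun hd => by
    have := hs P hP hd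
    rw [List.length_ofFn] at hht
    have h2 := lt_of_lt_of_le this hht
    have : n + η < n + 2 := by exact_mod_cast h2
    omega
  obtain ⟨w, -, hw, -⟩ := exists_parameters_of_not_dep (fun i => hle (Ideal.subset_span ⟨i, rfl⟩)) hnd
  exact hw

theorem SmoothSeq.prime_and_regR {η : ℕ} (hη : 2 ≤ η) {n : ℕ} {y : Fin n → MvPolynomial (Fin N) K}
    (hom : ∀ i, ∃ e, 0 < e ∧ (y i).IsHomogeneous e) (hs : SmoothSeq η y) :
    (Ideal.span (Set.range y)).IsPrime ∧ RegR ⊥ (List.ofFn y) := by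
  induction n with
  | zero =>
    have : RegR ⊥ (List.ofFn y) := by simp [RegR]
    exact ⟨hs.prime_of_regR hη hom this, this⟩
  | succ n ih =>
    have hs' : SmoothSeq η (y ∘ Fin.castSucc) := hs.comp (Fin.castSucc_injective n)
    obtain ⟨hp, hr⟩ := ih (y := y ∘ Fin.castSucc) (fun i => hom _) hs'
    have hlast : y (Fin.last n) ∉ Ideal.span (Set.range (y ∘ Fin.castSucc)) := by
      intro hmem
      have hht := height_le_of_minimalPrimes_span_range
        (P := Ideal.span (Set.range (y ∘ Fin.castSucc))) (y := y ∘ Fin.castSucc)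
        (by rw [Ideal.minimalPrimes_eq_subsingleton_self]; rfl)
      have hy : ∀ i, y i ∈ Ideal.span (Set.range (y ∘ Fin.castSucc)) := by
        intro i
        refine Fin.lastCases hmem (fun i => Ideal.subset_span ⟨i, rfl⟩) i
      have hnd : ¬ Dep (Ideal.span (Set.range (y ∘ Fin.castSucc))) y := fun hd => by
        have h2 := lt_of_lt_of_le (hs _ hp hd) hht
        have : n + 1 + η < n := by exact_mod_cast h2
        omega
      have h3 := (length_le_height_of_not_dep hy hnd).trans hht
      have : n + 1 ≤ n := by exact_mod_cast h3
      omega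
    have hreg : RegR ⊥ (List.ofFn y) := by
      rw [List.ofFn_succ', List.concat_eq_append]
      refine RegR.snoc hr ?_
      rw [bot_sup_eq]
      have := ofList_ofFn (y ∘ Fin.castSucc)
      rw [show (fun i => y (Fin.castSucc i)) = y ∘ Fin.castSucc from rfl, this]
      exact NZD.of_prime hp hlast
    exact ⟨hs.prime_of_regR hη hom hreg, hreg⟩

end

section

variable {K : Type*} [Field K] {N : ℕ}

theorem homogeneousComponent_mul_sub_C {f g : MvPolynomial (Fin N) K} {e : ℕ} (hg : g.IsHomogeneous e)
    (a : K) (k : ℕ) : homogeneousComponent k (f * (g - C a)) =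
      (if e ≤ k then homogeneousComponent (k - e) f * g else 0) - C a * homogeneousComponent k f := by
  rw [mul_sub, map_sub, homogeneousComponent_mul_of_isHomogeneous _ hg, mul_comm f, homogeneousComponent_C_mul]

/-- Lifting a top form along the deformation `y i - a i` of `y i`. -/
theorem exists_mem_span_sub_C {n : ℕ} {y : Fin n → MvPolynomial (Fin N) K}
    (hom : ∀ i, ∃ e, 0 < e ∧ (y i).IsHomogeneous e) (a : Fin n → K) {f : MvPolynomial (Fin N) K}
    (hf : f ∈ Ideal.span (Set.range y)) (s : ℕ) :
    ∃ j ∈ Ideal.span (Set.range fun i => y i - C (a i)),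
      homogeneousComponent s j = homogeneousComponent s f ∧ ∀ E, s < E → homogeneousComponent E j = 0 := by
  choose e he0 he using hom
  obtain ⟨b, rfl⟩ := Ideal.mem_span_range_iff_exists_fun.1 hf
  have h1 : ∀ i k, homogeneousComponent k (if e i ≤ s then homogeneousComponent (s - e i) (b i) else 0) =
      if e i ≤ s ∧ k = s - e i then homogeneousComponent (s - e i) (b i) else 0 := by
    intro i k
    split_ifs with h2 h3 h3
    · rw [homogeneousComponent_of_mem (homogeneousComponent_isHomogeneous _ _), if_pos h3.2]
    · rw [homogeneousComponent_of_mem (homogeneousComponent_isHomogeneous _ _),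
        if_neg fun h => h3 ⟨h2, h⟩]
    · exact absurd h3.1 h2
    · simp
  refine ⟨∑ i, (if e i ≤ s then homogeneousComponent (s - e i) (b i) else 0) * (y i - C (a i)), ?_, ?_, ?_⟩
  · exact sum_mem fun i _ => Ideal.mul_mem_left _ _ (Ideal.subset_span ⟨i, rfl⟩)
  · rw [map_sum, map_sum]
    refine Finset.sum_congr rfl fun i _ => ?_
    rw [homogeneousComponent_mul_sub_C (he i), homogeneousComponent_mul_of_isHomogeneous _ (he i), h1, h1]
    have := he0 i
    rw [if_neg (c := _ ∧ s = s - e i) (by omega)]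
    split_ifs <;> simp_all
  · intro E hE
    rw [map_sum]
    refine Finset.sum_eq_zero fun i _ => ?_
    rw [homogeneousComponent_mul_sub_C (he i), h1, h1]
    have := he0 i
    rw [if_neg (c := _ ∧ E = s - e i) (by omega), if_neg (c := _ ∧ E - e i = s - e i) (by omega)]
    simp

theorem homogeneousComponent_mem_span_of_deformation {n : ℕ} {y : Fin n → MvPolynomial (Fin N) K}
    (hom : ∀ i, ∃ e, 0 < e ∧ (y i).IsHomogeneous e) (hreg : RegR ⊥ (List.ofFn y)) (a : Fin n → K)
    {h : MvPolynomial (Fin N) K} (hh : h ∈ Ideal.span (Set.range fun i => y i - C (a i))) {D : ℕ}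
    (hD : ∀ E, D < E → homogeneousComponent E h = 0) :
    homogeneousComponent D h ∈ Ideal.span (Set.range y) := by
  induction n generalizing h D with
  | zero =>
    have : h = 0 := by simpa using hh
    subst this
    simp
  | succ n ih =>
    have hrange : ∀ z : Fin (n + 1) → MvPolynomial (Fin N) K, Ideal.span (Set.range z) =
        Ideal.span (Set.range (z ∘ Fin.castSucc)) ⊔ Ideal.span {z (Fin.last n)} := by
      intro z
      rw [← Ideal.span_union]
      congr 1
      ext x
      simp only [Set.mem_range, Fin.exists_fin_succ', Set.mem_union, Set.mem_singleton_iff,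
        Function.comp_apply, eq_comm]
    rw [List.ofFn_succ', List.concat_eq_append, RegR.append_iff] at hreg
    obtain ⟨hreg', hnzd, -⟩ := hreg
    rw [bot_sup_eq, ofList_ofFn] at hnzd
    have hcomp : ∀ f, f ∈ Ideal.span (Set.range (y ∘ Fin.castSucc)) → f ∈ Ideal.span (Set.range y) :=
      fun f hf => by rw [hrange]; exact Ideal.mem_sup_left hf
    obtain ⟨e, he0, he⟩ := hom (Fin.last n)
    have ih' := fun {g} hg {D} => ih (y := y ∘ Fin.castSucc) (fun i => hom _) hreg' (a ∘ Fin.castSucc)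
      (h := g) hg (D := D)
    set J := Ideal.span (Set.range fun i => (y ∘ Fin.castSucc) i - C ((a ∘ Fin.castSucc) i)) with hJ
    have key : ∀ s : ℕ, ∀ g ∈ J, ∀ c : MvPolynomial (Fin N) K,
        (∀ E, s ≤ E → homogeneousComponent E c = 0) → ∀ D,
        (∀ E, D < E → homogeneousComponent E (g + c * (y (Fin.last n) - C (a (Fin.last n)))) = 0) →
        homogeneousComponent D (g + c * (y (Fin.last n) - C (a (Fin.last n)))) ∈
          Ideal.span (Set.range y) := by
      intro s
      induction s with
      | zero =>
        intro g hg c hc D hD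
        have hc0 : c = 0 := by
          rw [← sum_homogeneousComponent c]
          exact Finset.sum_eq_zero fun i _ => hc i (Nat.zero_le _)
        subst hc0
        simp only [zero_mul, add_zero] at hD ⊢
        exact hcomp _ (ih' hg hD)
      | succ s ihs =>
        intro g hg c hc D hD
        simp only [map_add, homogeneousComponent_mul_sub_C he] at hD ⊢
        have hgE : ∀ E, D < E → s + e < E → homogeneousComponent E g = 0 := by
          intro E hE1 hE2
          have h2 := hD E hE1
          rw [hc E (by omega), hc (E - e) (by omega)] at h2
          simpa using h2
        by_cases hDs : s + e ≤ D
        · rw [hc D (by omega), mul_zero, sub_zero]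
          refine add_mem (hcomp _ (ih' hg fun E hE => hgE E hE (by omega))) ?_
          split_ifs
          · exact Ideal.mul_mem_left _ _ (Ideal.subset_span ⟨_, rfl⟩)
          · exact Ideal.zero_mem _
        · push Not at hDs
          have h1 := hD (s + e) hDs
          rw [if_pos (by omega), hc (s + e) (by omega), mul_zero, sub_zero, Nat.add_sub_cancel] at h1
          have h2 := ih' hg (D := s + e) (fun E hE => hgE E (by omega) hE)
          have h3 : homogeneousComponent s c ∈ Ideal.span (Set.range (y ∘ Fin.castSucc)) := by
            refine hnzd _ ?_
            rw [mul_comm, eq_neg_of_add_eq_zero_right h1]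
            exact neg_mem h2
          obtain ⟨j, hj, hjs, hjE⟩ := exists_mem_span_sub_C (fun i => hom (Fin.castSucc i))
            (a ∘ Fin.castSucc) h3 s
          rw [homogeneousComponent_of_mem (homogeneousComponent_isHomogeneous _ _), if_pos rfl] at hjs
          have h4 := ihs (g + j * (y (Fin.last n) - C (a (Fin.last n))))
            (add_mem hg (Ideal.mul_mem_right _ _ hj)) (c - j) (by
              intro E hE
              rw [map_sub]
              rcases hE.eq_or_lt with rfl | hE
              · rw [hjs, sub_self]
              · rw [hjE E hE, hc E hE, sub_zero]) D
          have h5 : g + j * (y (Fin.last n) - C (a (Fin.last n))) +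
              (c - j) * (y (Fin.last n) - C (a (Fin.last n))) =
              g + c * (y (Fin.last n) - C (a (Fin.last n))) := by ring
          simp only [h5, map_add, homogeneousComponent_mul_sub_C he] at h4
          exact h4 hD
    rw [hrange] at hh
    obtain ⟨c, hc⟩ := mem_sup_span_singleton.1 hh
    have h1 := key (c.totalDegree + 1) _ hc c (fun E hE => homogeneousComponent_eq_zero _ _ hE) D
    rw [show h - (y (Fin.last n) - C (a (Fin.last n))) * c +
      c * (y (Fin.last n) - C (a (Fin.last n))) = h by ring] at h1
    exact h1 hD

theorem isPrime_span_sub_C {n : ℕ} {y : Fin n → MvPolynomial (Fin N) K}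
    (hom : ∀ i, ∃ e, 0 < e ∧ (y i).IsHomogeneous e) (hreg : RegR ⊥ (List.ofFn y))
    (hp : (Ideal.span (Set.range y)).IsPrime) (a : Fin n → K) :
    (Ideal.span (Set.range fun i => y i - C (a i))).IsPrime := by
  set J := Ideal.span (Set.range fun i => y i - C (a i)) with hJ
  -- reduced representatives
  have hred : ∀ s : ℕ, ∀ f : MvPolynomial (Fin N) K, (∀ E, s ≤ E → homogeneousComponent E f = 0) →
      f ∉ J → ∃ f' D, f - f' ∈ J ∧ (∀ E, D < E → homogeneousComponent E f' = 0) ∧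
        homogeneousComponent D f' ∉ Ideal.span (Set.range y) := by
    intro s
    induction s with
    | zero =>
      intro f hf hfJ
      have hc0 : f = 0 := by
        rw [← sum_homogeneousComponent f]
        exact Finset.sum_eq_zero fun i _ => hf i (Nat.zero_le _)
      subst hc0
      exact absurd J.zero_mem hfJ
    | succ s ih =>
      intro f hf hfJ
      by_cases hs : homogeneousComponent s f ∈ Ideal.span (Set.range y)
      · obtain ⟨j, hj, hjs, hjE⟩ := exists_mem_span_sub_C hom a hs s
        rw [homogeneousComponent_of_mem (homogeneousComponent_isHomogeneous _ _), if_pos rfl] at hjs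
        obtain ⟨f', D, h1, h2, h3⟩ := ih (f - j) (by
          intro E hE
          rw [map_sub]
          rcases hE.eq_or_lt with rfl | hE
          · rw [hjs, sub_self]
          · rw [hjE E hE, hf E hE, sub_zero]) (fun h => hfJ ((J.sub_mem_iff_left hj).1 h))
        refine ⟨f', D, ?_, h2, h3⟩
        have := add_mem h1 hj
        convert this using 1
        ring
      · exact ⟨f, s, by simp, fun E hE => hf E hE, hs⟩
  have hred' : ∀ f : MvPolynomial (Fin N) K,
      f ∉ J → ∃ f' D, f - f' ∈ J ∧ (∀ E, D < E → homogeneousComponent E f' = 0) ∧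
        homogeneousComponent D f' ∉ Ideal.span (Set.range y) := fun f hf =>
    hred (f.totalDegree + 1) f (fun E hE => homogeneousComponent_eq_zero _ _ hE) hf
  have htop := fun {h} hh {D} => homogeneousComponent_mem_span_of_deformation hom hreg a (h := h) hh (D := D)
  refine ⟨fun h => ?_, fun {f g} hfg => ?_⟩
  · have h1 := htop (h := 1) (by rw [← hJ, h]; exact Submodule.mem_top) (D := 0) (fun E hE => by
      rw [homogeneousComponent_eq_zero]; simpa using hE)
    rw [homogeneousComponent_zero] at h1
    exact hp.ne_top ((Ideal.eq_top_iff_one _).2 (by simpa using h1))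
  · by_contra hcon
    push Not at hcon
    obtain ⟨f', D, hf1, hf2, hf3⟩ := hred' f hcon.1
    obtain ⟨g', E, hg1, hg2, hg3⟩ := hred' g hcon.2
    have hfg' : f' * g' ∈ J := by
      have h1 := sub_mem (sub_mem hfg (J.mul_mem_left f' hg1)) (J.mul_mem_left g hf1)
      convert h1 using 1
      ring
    have hmul : ∀ k, homogeneousComponent k (f' * g') =
        ∑ j ∈ Finset.range (g'.totalDegree + 1), if j ≤ k then
          homogeneousComponent (k - j) f' * homogeneousComponent j g' else 0 := by
      intro k
      conv_lhs => rw [← sum_homogeneousComponent g']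
      rw [Finset.mul_sum, map_sum]
      exact Finset.sum_congr rfl fun j _ =>
        homogeneousComponent_mul_of_isHomogeneous _ (homogeneousComponent_isHomogeneous j g') k
    have h1 := htop hfg' (D := D + E) (by
      intro k hk
      rw [hmul]
      refine Finset.sum_eq_zero fun j _ => ?_
      split_ifs with hjk
      · by_cases hj : E < j
        · rw [hg2 j hj, mul_zero]
        · rw [hf2 (k - j) (by omega), zero_mul]
      · rfl)
    have hE : E ∈ Finset.range (g'.totalDegree + 1) := by
      by_contra h
      refine hg3 ?_
      rw [homogeneousComponent_eq_zero _ _ (by simp at h; omega)]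
      exact Ideal.zero_mem _
    rw [hmul, Finset.sum_eq_single_of_mem E hE, if_pos (by omega), Nat.add_sub_cancel] at h1
    · exact (hp.mem_or_mem h1).elim hf3 hg3
    · intro j _ hj
      split_ifs with hjk
      · by_cases hj' : E < j
        · rw [hg2 j hj', mul_zero]
        · rw [hf2 (D + E - j) (by omega), zero_mul]
      · rfl

theorem exists_mem_minimalPrimes_sep {A : Type*} [CommRing A] [IsNoetherianRing A] {I P : Ideal A}
    (hP : P ∈ I.minimalPrimes) : ∃ u, u ∉ P ∧ ∀ Q ∈ I.minimalPrimes, Q ≠ P → u ∈ Q := by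
  classical
  have hfin := I.finite_minimalPrimes_of_isNoetherianRing
  have hprime : P.IsPrime := hP.1.1
  have h1 : ∀ Q ∈ I.minimalPrimes, Q ≠ P → ∃ u, u ∈ Q ∧ u ∉ P := by
    intro Q hQ hne
    by_contra hcon
    push Not at hcon
    exact hne (le_antisymm hcon (hP.2 hQ.1 hcon))
  choose! u hu using h1
  refine ⟨∏ Q ∈ hfin.toFinset.erase P, u Q, fun hmem => ?_, fun Q hQ hne => ?_⟩
  · obtain ⟨Q, hQ, hQP⟩ := (Ideal.IsPrime.prod_mem_iff (p := P)).1 hmem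
    rw [Finset.mem_erase, Set.Finite.mem_toFinset] at hQ
    exact (hu Q hQ.2 hQ.1).2 hQP
  · exact Ideal.mem_of_dvd _ (Finset.dvd_prod_of_mem u (by simp [hQ, hne])) (hu Q hQ hne).1

theorem exists_point_of_not_mem [IsAlgClosed K] {P : Ideal (MvPolynomial (Fin N) K)} (hP : P.IsPrime)
    {u : MvPolynomial (Fin N) K} (hu : u ∉ P) :
    ∃ x : Fin N → K, (∀ f ∈ P, eval x f = 0) ∧ eval x u ≠ 0 := by
  by_contra hcon
  push Not at hcon
  have h := MvPolynomial.vanishingIdeal_zeroLocus_eq_radical (k := K) (K := K) P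
  rw [hP.radical] at h
  refine hu ?_
  rw [← h, mem_vanishingIdeal_iff]
  intro x hx
  rw [mem_zeroLocus_iff] at hx
  have := hcon x (fun f hf => by simpa [aeval_eq_eval] using hx f hf)
  simpa [aeval_eq_eval] using this

/-- A minimal prime of an ideal generated by elements of `K[y]` is contained in a fibre ideal. -/
theorem exists_le_span_sub_C [IsAlgClosed K] {n : ℕ} {y : Fin n → MvPolynomial (Fin N) K}
    (hom : ∀ i, ∃ e, 0 < e ∧ (y i).IsHomogeneous e) (hreg : RegR ⊥ (List.ofFn y))
    (hp : (Ideal.span (Set.range y)).IsPrime) {s : Set (MvPolynomial (Fin N) K)}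
    (hs : ∀ g ∈ s, g ∈ Algebra.adjoin K (Set.range y)) {Q : Ideal (MvPolynomial (Fin N) K)}
    (hQ : Q ∈ (Ideal.span s).minimalPrimes) :
    ∃ a : Fin n → K, Q ≤ Ideal.span (Set.range fun i => y i - C (a i)) := by
  obtain ⟨u, huQ, hu⟩ := exists_mem_minimalPrimes_sep hQ
  obtain ⟨x, hx, hxu⟩ := exists_point_of_not_mem hQ.1.1 huQ
  refine ⟨fun i => eval x (y i), ?_⟩
  set J := Ideal.span (Set.range fun i => y i - C (eval x (y i))) with hJ
  have hJp : J.IsPrime := isPrime_span_sub_C hom hreg hp _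
  have hJx : ∀ f ∈ J, eval x f = 0 := by
    have : J ≤ RingHom.ker (eval x) := by
      rw [hJ, Ideal.span_le]
      rintro _ ⟨i, rfl⟩
      simp [RingHom.mem_ker]
    exact fun f hf => this hf
  have hred : ∀ g ∈ Algebra.adjoin K (Set.range y), g - C (eval x g) ∈ J := by
    intro g hg
    induction hg using Algebra.adjoin_induction with
    | mem f hf => obtain ⟨i, rfl⟩ := hf; exact Ideal.subset_span ⟨i, rfl⟩
    | algebraMap r => simp [algebraMap_eq]
    | add f g _ _ hf hg =>
      have := add_mem hf hg
      rw [map_add, C_add]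
      convert this using 1
      ring
    | mul f g _ _ hf hg =>
      have := add_mem (J.mul_mem_left g hf) (J.mul_mem_left (C (eval x f)) hg)
      rw [map_mul, C_mul]
      convert this using 1
      ring
  have hle : Ideal.span s ≤ J := by
    rw [Ideal.span_le]
    intro g hg
    have h1 := hred g (hs g hg)
    rwa [hx g (hQ.1.2 (Ideal.subset_span hg)), C_0, sub_zero] at h1
  obtain ⟨P, hP, hPJ⟩ := Ideal.exists_minimalPrimes_le hle
  by_cases hPQ : P = Q
  · exact hPQ ▸ hPJ
  · exact absurd (hJx _ (hPJ (hu P hP hPQ))) hxu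

end

section FieldLemma

theorem minpoly_eq_X_pow_sub_C_of_pow_mem {L : Type*} [Field L] {p : ℕ} [Fact p.Prime] [CharP L p]
    (M : Subfield L) {z : L} (hz : z ∉ M) (hzp : z ^ p ∈ M) :
    minpoly M z = Polynomial.X ^ p - Polynomial.C (⟨z ^ p, hzp⟩ : M) := by
  have hp : p.Prime := Fact.out
  symm
  refine minpoly.eq_of_irreducible_of_monic (X_pow_sub_C_irreducible_of_prime hp ?_) ?_
    (Polynomial.monic_X_pow_sub_C _ hp.ne_zero)
  · intro b hb
    have h1 : (b : L) ^ p = z ^ p := congrArg Subtype.val hb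
    have h2 : (b : L) = z := frobenius_inj L p h1
    exact hz (h2 ▸ b.2)
  · rw [map_sub, map_pow, Polynomial.aeval_X, Polynomial.aeval_C]
    exact sub_self _

open IntermediateField in
/-- Above a subfield containing all `p`-th powers and maximal without `φ`, everything is a
polynomial in `φ`. -/
theorem exists_subfield_adjoin {L : Type*} [Field L] {p : ℕ} [Fact p.Prime] [CharP L p] {φ : L}
    (hφ : ∀ b : L, b ^ p ≠ φ) : ∃ M : Subfield L, φ ∉ M ∧ (∀ z : L, z ^ p ∈ M) ∧
      ∀ z : L, ∃ q : Polynomial M, Polynomial.aeval φ q = z := by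
  have hp : p.Prime := Fact.out
  obtain ⟨M, hM0, hMs, hM⟩ := zorn_le_nonempty₀ {M : Subfield L | φ ∉ M} (by
    intro c hc hchain y hy
    refine ⟨sSup c, ?_, fun z hz => le_sSup hz⟩
    change φ ∉ sSup c
    rw [Subfield.mem_sSup_of_directedOn ⟨y, hy⟩ hchain.directedOn]
    rintro ⟨M, hM, hφM⟩
    exact hc hM hφM) (frobenius L p).fieldRange (by
      rintro ⟨b, hb⟩
      exact hφ b hb)
  have hpow : ∀ z : L, z ^ p ∈ M := fun z => hM0 ⟨z, rfl⟩
  refine ⟨M, hMs, hpow, fun z => ?_⟩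
  have hintM : ∀ z : L, IsIntegral M z := fun z =>
    ⟨Polynomial.X ^ p - Polynomial.C (⟨z ^ p, hpow z⟩ : M), Polynomial.monic_X_pow_sub_C _ hp.ne_zero, by
      rw [← Polynomial.aeval_def, map_sub, map_pow, Polynomial.aeval_X, Polynomial.aeval_C]
      exact sub_self _⟩
  suffices hz : z ∈ M⟮φ⟯ by
    rw [← mem_toSubalgebra, adjoin_simple_toSubalgebra_of_isAlgebraic (hintM φ).isAlgebraic,
      Algebra.adjoin_singleton_eq_range_aeval] at hz
    exact hz
  by_cases hzM : z ∈ M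
  · exact M⟮φ⟯.algebraMap_mem ⟨z, hzM⟩
  have hφz : φ ∈ M⟮z⟯ := by
    by_contra hcon
    have h1 : M ≤ (M⟮z⟯).toSubfield := fun x hx => M⟮z⟯.algebraMap_mem ⟨x, hx⟩
    exact hzM (hM (y := (M⟮z⟯).toSubfield) hcon h1 (mem_adjoin_simple_self M z))
  have hle : M⟮φ⟯ ≤ M⟮z⟯ := by
    rw [adjoin_simple_le_iff]; exact hφz
  have hdeg : ∀ z : L, z ∉ M → Module.finrank M M⟮z⟯ = p := by
    intro z hz
    rw [adjoin.finrank (hintM z), minpoly_eq_X_pow_sub_C_of_pow_mem M hz (hpow z),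
      Polynomial.natDegree_X_pow_sub_C]
  have : FiniteDimensional M M⟮z⟯ := adjoin.finiteDimensional (hintM z)
  rw [eq_of_le_of_finrank_eq hle (by rw [hdeg _ hMs, hdeg _ hzM])]
  exact mem_adjoin_simple_self M z

theorem derivative_eval₂_C_comp {K M : Type*} [Field K] [Field M] {N : ℕ} (ψ : K →+* M)
    (q : Fin N → Polynomial M) (F : MvPolynomial (Fin N) K) :
    Polynomial.derivative (eval₂ (Polynomial.C.comp ψ) q F) =
      ∑ j, eval₂ (Polynomial.C.comp ψ) q (pderiv j F) * Polynomial.derivative (q j) := by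
  induction F using MvPolynomial.induction_on with
  | C a => simp
  | add f g hf hg => simp [hf, hg, add_mul, Finset.sum_add_distrib]
  | mul_X f i hf =>
    have h1 : ∀ j, eval₂ (Polynomial.C.comp ψ) q (pderiv j (f * X i)) * Polynomial.derivative (q j) =
        eval₂ (Polynomial.C.comp ψ) q (pderiv j f) * Polynomial.derivative (q j) * q i +
          (if i = j then eval₂ (Polynomial.C.comp ψ) q f * Polynomial.derivative (q j) else 0) := by
      intro j
      rw [Derivation.leibniz, eval₂_add, smul_eq_mul, smul_eq_mul, eval₂_mul, eval₂_mul, eval₂_X, pderiv_X]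
      split_ifs with h
      · subst h
        rw [Pi.single_eq_same, eval₂_one]
        ring
      · rw [Pi.single_eq_of_ne (fun h' => h h'), eval₂_zero]
        ring
    rw [eval₂_mul, eval₂_X, Polynomial.derivative_mul, hf, Finset.sum_congr rfl fun j _ => h1 j,
      Finset.sum_add_distrib, Finset.sum_mul, Finset.sum_ite_eq, if_pos (Finset.mem_univ i)]

/-- A polynomial expression with vanishing gradient is a `p`-th power. -/
theorem exists_pow_eq_of_pderiv_eq_zero {K L : Type*} [Field K] [IsAlgClosed K] [Field L] {N : ℕ} (ι : K →+* L)
    {p : ℕ} [Fact p.Prime] [CharP L p] {x : Fin N → L} {F : MvPolynomial (Fin N) K}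
    (hF : ∀ j, eval₂ ι x (pderiv j F) = 0) : ∃ b : L, b ^ p = eval₂ ι x F := by
  have hp : p.Prime := Fact.out
  by_contra hcon
  push Not at hcon
  obtain ⟨M, hφM, hpow, hadj⟩ := exists_subfield_adjoin hcon
  have hι : ∀ a, ι a ∈ M := by
    intro a
    obtain ⟨b, hb⟩ := IsAlgClosed.exists_pow_nat_eq a hp.pos
    rw [← hb, map_pow]
    exact hpow _
  let ψ : K →+* M := ι.codRestrict M hι
  choose q hq using fun j => hadj (x j)
  set φ := eval₂ ι x F with hφ
  have hcomp : ∀ G : MvPolynomial (Fin N) K,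
      Polynomial.aeval φ (eval₂ (Polynomial.C.comp ψ) q G) = eval₂ ι x G := by
    intro G
    have h1 : (Polynomial.aeval φ).toRingHom (eval₂ (Polynomial.C.comp ψ) q G) =
      eval₂ (((Polynomial.aeval φ).toRingHom).comp (Polynomial.C.comp ψ)) (fun i => Polynomial.aeval φ (q i)) G :=
      eval₂_comp_left (Polynomial.aeval φ).toRingHom _ _ _
    refine h1.trans ?_
    congr 1
    · ext a
      simp only [RingHom.comp_apply]
      change Polynomial.aeval φ (Polynomial.C (ψ a)) = _
      rw [Polynomial.aeval_C]
      rfl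
    · exact funext hq
  have h0 : Polynomial.aeval φ (eval₂ (Polynomial.C.comp ψ) q F - Polynomial.X) = 0 := by
    rw [map_sub, hcomp, Polynomial.aeval_X, sub_self]
  obtain ⟨H, hH⟩ := minpoly.dvd M φ h0
  have hM : CharP M p := (RingHom.charP_iff M.subtype M.subtype_injective p).2 inferInstance
  have hd : Polynomial.derivative (minpoly M φ) = 0 := by
    rw [minpoly_eq_X_pow_sub_C_of_pow_mem M hφM (hpow φ)]
    rw [Polynomial.derivative_sub, Polynomial.derivative_C, Polynomial.derivative_X_pow, CharP.cast_eq_zero,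
      map_zero, zero_mul, sub_zero]
  have h1 := congrArg (fun Q => Polynomial.aeval φ (Polynomial.derivative Q)) hH
  simp only [Polynomial.derivative_mul, hd, zero_mul, zero_add, map_mul, minpoly.aeval,
    derivative_eval₂_C_comp, Polynomial.derivative_X, map_sub, map_sum, map_one,
    hcomp, hF, Finset.sum_const_zero, zero_sub] at h1
  exact one_ne_zero (neg_eq_zero.1 h1)

end FieldLemma

section

variable {K : Type*} [Field K] {N : ℕ}

theorem maximalIdeal_quotient_eq_map {A : Type*} [CommRing A] [IsLocalRing A] {I : Ideal A}
    [IsLocalRing (A ⧸ I)] (hI : I ≠ ⊤) :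
    IsLocalRing.maximalIdeal (A ⧸ I) = (IsLocalRing.maximalIdeal A).map (Ideal.Quotient.mk I) := by
  have hm := IsLocalRing.maximalIdeal.isMaximal A
  refine (IsLocalRing.eq_maximalIdeal ?_).symm
  refine (Ideal.map_eq_top_or_isMaximal_of_surjective (Ideal.Quotient.mk I) Ideal.Quotient.mk_surjective
    hm).resolve_left fun h => ?_
  have h2 := Ideal.comap_map_of_surjective (Ideal.Quotient.mk I) Ideal.Quotient.mk_surjective
    (IsLocalRing.maximalIdeal A)
  rw [h, Ideal.comap_top, ← RingHom.ker_eq_comap_bot, Ideal.mk_ker, sup_eq_left.2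
    (IsLocalRing.le_maximalIdeal hI)] at h2
  exact hm.ne_top h2.symm

theorem dvd_of_pow_mul_eq_pow {A : Type*} [CommRing A] [IsDomain A] [IsLocalRing A] [IsNoetherianRing A]
    (hprin : (IsLocalRing.maximalIdeal A).IsPrincipal) {p : ℕ} (hp0 : p ≠ 0) {a b f : A} (hb0 : b ≠ 0)
    (hpow : b ^ p * f = a ^ p) : b ∣ a := by
  have hval : ValuationRing A :=
    ((tfae_of_isNoetherianRing_of_isLocalRing_of_isDomain A).out 4 1).1 hprin
  rcases ValuationRing.dvd_total b a with h | ⟨k, hk⟩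
  · exact h
  · have ha0 : a ≠ 0 := fun h => hb0 (by rw [hk, h, zero_mul])
    have h1 : k ^ p * f = 1 := by
      have h2 : a ^ p * (k ^ p * f) = a ^ p * 1 := by
        rw [mul_one, ← mul_assoc, ← mul_pow, ← hk, hpow]
      exact mul_left_cancel₀ (pow_ne_zero _ ha0) h2
    have hu : IsUnit k := (isUnit_pow_iff hp0).1 (IsUnit.of_mul_eq_one _ h1)
    rw [hk]
    exact (IsUnit.mul_right_dvd hu).2 dvd_rfl

theorem eval₂_fractionRing_mk {I : Ideal (MvPolynomial (Fin N) K)} (F : MvPolynomial (Fin N) K)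
    {L : Type*} [CommRing L] [Algebra (MvPolynomial (Fin N) K ⧸ I) L] :
    eval₂ ((algebraMap (MvPolynomial (Fin N) K ⧸ I) L).comp ((Ideal.Quotient.mk I).comp C))
      (fun j => algebraMap _ L (Ideal.Quotient.mk I (X j))) F =
      algebraMap (MvPolynomial (Fin N) K ⧸ I) L (Ideal.Quotient.mk I F) := by
  have h1 := eval₂_comp_left ((algebraMap (MvPolynomial (Fin N) K ⧸ I) L).comp (Ideal.Quotient.mk I))
    C X F
  rw [eval₂_eta] at h1
  exact h1.symm

theorem exists_pow_sub_mem_of_pderiv_mem [IsAlgClosed K] {η : ℕ} (hη : 2 ≤ η) {n : ℕ}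
    {y : Fin n → MvPolynomial (Fin N) K} (hom : ∀ i, ∃ e, 0 < e ∧ (y i).IsHomogeneous e)
    (hs : SmoothSeq η y) {p : ℕ} [hp : Fact p.Prime] [CharP K p] {F : MvPolynomial (Fin N) K}
    (hF : ∀ j, pderiv j F ∈ Ideal.span (Set.range y)) :
    ∃ G, F - G ^ p ∈ Ideal.span (Set.range y) := by
  obtain ⟨hI, hreg⟩ := hs.prime_and_regR hη hom
  have hp0 : p ≠ 0 := hp.out.ne_zero
  obtain ⟨a, b, hb, hab⟩ : ∃ a b, b ∉ Ideal.span (Set.range y) ∧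
      b ^ p * F - a ^ p ∈ Ideal.span (Set.range y) := by
    have : IsDomain (MvPolynomial (Fin N) K ⧸ Ideal.span (Set.range y)) := Ideal.Quotient.isDomain _
    set S := MvPolynomial (Fin N) K ⧸ Ideal.span (Set.range y) with hS
    let L := FractionRing S
    let ι : K →+* L := (algebraMap S L).comp ((Ideal.Quotient.mk (Ideal.span (Set.range y))).comp C)
    have : CharP L p := (RingHom.charP_iff ι ι.injective p).1 inferInstance
    obtain ⟨g, hg⟩ := exists_pow_eq_of_pderiv_eq_zero (K := K) (L := L) ι (p := p)
      (x := fun j => algebraMap S L (Ideal.Quotient.mk _ (X j))) (F := F) (by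
        intro j
        rw [eval₂_fractionRing_mk, Ideal.Quotient.eq_zero_iff_mem.2 (hF j), map_zero])
    rw [eval₂_fractionRing_mk] at hg
    obtain ⟨a', b', hb', rfl⟩ := IsFractionRing.div_surjective (A := S) g
    obtain ⟨a, rfl⟩ := Ideal.Quotient.mk_surjective a'
    obtain ⟨b, rfl⟩ := Ideal.Quotient.mk_surjective b'
    have hb0 : Ideal.Quotient.mk (Ideal.span (Set.range y)) b ≠ 0 := nonZeroDivisors.ne_zero hb'
    refine ⟨a, b, fun h => hb0 (Ideal.Quotient.eq_zero_iff_mem.2 h), ?_⟩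
    rw [← Ideal.Quotient.eq_zero_iff_mem, map_sub, map_mul, map_pow, map_pow]
    have hb1 : algebraMap S L (Ideal.Quotient.mk (Ideal.span (Set.range y)) b) ≠ 0 := by
      rwa [Ne, IsFractionRing.to_map_eq_zero_iff]
    apply IsFractionRing.injective S L
    rw [map_sub, map_mul, map_pow, map_pow, map_zero, ← hg, div_pow, mul_div_cancel₀ _ (pow_ne_zero _ hb1),
      sub_self]
  have haJ : a ∈ Ideal.span (Set.range y) ⊔ Ideal.span {b} := by
    by_contra hcon
    obtain ⟨P, hP, hPa⟩ := exists_assocP hcon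
    have hPp := hP.1
    have hle : Ideal.span (Set.range y) ≤ P := le_sup_left.trans hP.le
    have hreg2 : RegR ⊥ (List.ofFn y ++ [b]) := hreg.snoc (by
      rw [bot_sup_eq, ofList_ofFn]
      exact NZD.of_prime hI hb)
    have hof : Ideal.ofList (List.ofFn y ++ [b]) = Ideal.span (Set.range y) ⊔ Ideal.span {b} := by
      rw [Ideal.ofList_append, ofList_ofFn, Ideal.ofList_singleton]
    have hht := height_le_of_assocP P hreg2 (hof ▸ hP)
    rw [List.length_append, List.length_singleton, List.length_ofFn] at hht
    have hnd : ¬ Dep P y := fun hd => by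
      have h2 := lt_of_lt_of_le (hs P hPp hd) hht
      have : n + η < n + 1 := by exact_mod_cast h2
      omega
    obtain ⟨w, hw1, hw2, hw3⟩ := exists_parameters_of_not_dep (fun i => hle (Ideal.subset_span ⟨i, rfl⟩)) hnd
    set I' := (Ideal.span (Set.range y)).map (algebraMap _ (Localization.AtPrime P)) with hI'
    rw [← hw3] at hht
    have hwl : w.length ≤ 1 := by
      have : n + w.length ≤ n + 1 := by exact_mod_cast hht
      omega
    have : IsDomain (Localization.AtPrime P ⧸ I') := Ideal.Quotient.isDomain _
    have : IsLocalRing (Localization.AtPrime P ⧸ I') :=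
      IsLocalRing.of_surjective' (Ideal.Quotient.mk I') Ideal.Quotient.mk_surjective
    have hmax : IsLocalRing.maximalIdeal (Localization.AtPrime P ⧸ I') =
        (IsLocalRing.maximalIdeal (Localization.AtPrime P)).map (Ideal.Quotient.mk I') :=
      maximalIdeal_quotient_eq_map hw2.ne_top
    have hprin : (IsLocalRing.maximalIdeal (Localization.AtPrime P ⧸ I')).IsPrincipal := by
      rw [hmax, ← hw1, Ideal.map_sup, Ideal.map_quotient_self, bot_sup_eq]
      match w, hwl with
      | [], _ =>
        rw [Ideal.ofList_nil, Ideal.map_bot]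
        exact bot_isPrincipal
      | [t], _ =>
        rw [Ideal.ofList_singleton, Ideal.map_span, Set.image_singleton]
        exact ⟨⟨_, rfl⟩⟩
    let π : MvPolynomial (Fin N) K →+* Localization.AtPrime P ⧸ I' :=
      (Ideal.Quotient.mk I').comp (algebraMap _ (Localization.AtPrime P))
    have hπ : ∀ f, π f = 0 ↔ f ∈ Ideal.span (Set.range y) := by
      intro f
      change Ideal.Quotient.mk I' (algebraMap _ (Localization.AtPrime P) f) = 0 ↔ _
      rw [Ideal.Quotient.eq_zero_iff_mem, hI', algebraMap_mem_map_iff]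
      constructor
      · rintro ⟨s, hs, hsf⟩
        exact (hI.mem_or_mem hsf).resolve_left fun h => hs (hle h)
      · exact fun h => ⟨1, fun h1 => hPp.ne_top ((Ideal.eq_top_iff_one _).2 h1), by rwa [one_mul]⟩
    have hpow : π b ^ p * π F = π a ^ p := by
      rw [← sub_eq_zero, ← map_pow, ← map_pow, ← map_mul, ← map_sub, hπ]
      exact hab
    have hb0 : π b ≠ 0 := fun h => hb ((hπ b).1 h)
    have hdvd : π b ∣ π a := dvd_of_pow_mul_eq_pow hprin hp0 hb0 hpow
    obtain ⟨k, hk⟩ := hdvd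
    obtain ⟨k, rfl⟩ := Ideal.Quotient.mk_surjective k
    have hmem : algebraMap _ (Localization.AtPrime P) a ∈
        (Ideal.span (Set.range y) ⊔ Ideal.span {b}).map (algebraMap _ (Localization.AtPrime P)) := by
      change Ideal.Quotient.mk I' (algebraMap _ _ a) = Ideal.Quotient.mk I' (algebraMap _ _ b) * _ at hk
      rw [← map_mul, Ideal.Quotient.eq] at hk
      rw [Ideal.map_sup, Ideal.map_span _ {b}, Set.image_singleton, mem_sup_span_singleton]
      exact ⟨k, hk⟩
    obtain ⟨s, hs, hsa⟩ := (algebraMap_mem_map_iff P).1 hmem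
    exact hs (hPa s hsa)
  obtain ⟨G, hG⟩ := mem_sup_span_singleton.1 haJ
  refine ⟨G, (hI.mem_or_mem (x := b ^ p) ?_).resolve_left fun h => hb (hI.mem_of_pow_mem _ h)⟩
  have h1 : a ^ p - (b * G) ^ p ∈ Ideal.span (Set.range y) :=
    Ideal.mem_of_dvd _ (sub_dvd_pow_sub_pow a (b * G) p) hG
  have h2 := add_mem hab h1
  convert h2 using 1
  ring

theorem homogeneousComponent_pow_char {p : ℕ} [hp : Fact p.Prime] [CharP K p]
    (G : MvPolynomial (Fin N) K) (m : ℕ) :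
    homogeneousComponent (m * p) (G ^ p) = homogeneousComponent m G ^ p := by
  conv_lhs => rw [← sum_homogeneousComponent G, ← frobenius_def, map_sum, map_sum]
  have h1 : ∀ i, homogeneousComponent (m * p) (frobenius _ p (homogeneousComponent i G)) =
      if i = m then homogeneousComponent m G ^ p else 0 := by
    intro i
    rw [frobenius_def, homogeneousComponent_of_mem ((homogeneousComponent_isHomogeneous i G).pow p)]
    simp only [Nat.mul_left_inj hp.out.ne_zero, eq_comm (a := m)]
    split_ifs with h
    · rw [h]
    · rfl
  rw [Finset.sum_congr rfl fun i _ => h1 i, Finset.sum_ite_eq']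
  split_ifs with h
  · rfl
  · rw [homogeneousComponent_eq_zero _ _ (by simp at h; omega), zero_pow hp.out.ne_zero]

theorem exists_isHomogeneous_pow_sub_mem [IsAlgClosed K] {η : ℕ} (hη : 2 ≤ η) {n : ℕ}
    {y : Fin n → MvPolynomial (Fin N) K} (hom : ∀ i, ∃ e, 0 < e ∧ (y i).IsHomogeneous e)
    (hs : SmoothSeq η y) {F : MvPolynomial (Fin N) K} {e : ℕ} (he : 2 ≤ e) (hFe : F.IsHomogeneous e)
    (hF : ∀ j, pderiv j F ∈ Ideal.span (Set.range y)) :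
    ∃ k m G, 0 < m ∧ m < e ∧ G.IsHomogeneous m ∧ F - G ^ (k + 1) ∈ Ideal.span (Set.range y) := by
  have heul := hFe.sum_X_mul_pderiv
  have hmem : (e : MvPolynomial (Fin N) K) * F ∈ Ideal.span (Set.range y) := by
    rw [← nsmul_eq_mul, ← heul]
    exact sum_mem fun j _ => Ideal.mul_mem_left _ _ (hF j)
  by_cases h0 : (e : K) = 0
  · obtain ⟨p, hp⟩ := CharP.exists K
    have hpe : p ∣ e := (CharP.cast_eq_zero_iff K p e).1 h0
    have hpp : p.Prime := (CharP.char_is_prime_or_zero K p).resolve_right fun h => by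
      subst h
      have := Nat.eq_zero_of_zero_dvd hpe
      omega
    have : Fact p.Prime := ⟨hpp⟩
    obtain ⟨G, hG⟩ := exists_pow_sub_mem_of_pderiv_mem hη hom hs (p := p) hF
    obtain ⟨m, rfl⟩ := hpe
    have hp2 := hpp.two_le
    refine ⟨p - 1, m, homogeneousComponent m G, ?_, ?_, homogeneousComponent_isHomogeneous _ _, ?_⟩
    · by_contra h
      have : m = 0 := by omega
      subst this
      omega
    · have : 0 < m := by
        by_contra h
        have : m = 0 := by omega
        subst this
        omega
      nlinarith
    · have h1 := homogeneousComponent_mem_span (by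
        rintro _ ⟨i, rfl⟩; obtain ⟨e, -, he⟩ := hom i; exact ⟨e, he⟩) hG (m * p)
      rw [map_sub, homogeneousComponent_pow_char, mul_comm m p, homogeneousComponent_of_mem hFe,
        if_pos rfl] at h1
      rwa [Nat.sub_add_cancel (by omega)]
  · refine ⟨0, 1, 0, one_pos, by omega, isHomogeneous_zero _ _ _, ?_⟩
    have h1 := Ideal.mul_mem_left _ (C (e : K)⁻¹) hmem
    rw [show ((e : ℕ) : MvPolynomial (Fin N) K) = C (e : K) by simp, ← mul_assoc, ← C_mul,
      inv_mul_cancel₀ h0, C_1, one_mul] at h1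
    simpa using h1

end

section

variable {K : Type*} [Field K] {N : ℕ}

/-- Dependence of gradients modulo a prime specialises to a scalar dependence modulo a prime of
slightly larger height. -/
theorem Dep.exists_scalars [IsAlgClosed K] {P : Ideal (MvPolynomial (Fin N) K)} (hP : P.IsPrime) {n : ℕ}
    {y : Fin n → MvPolynomial (Fin N) K} (hd : Dep P y) :
    ∃ l : Fin n → K, (∃ i, l i ≠ 0) ∧ ∃ Q : Ideal (MvPolynomial (Fin N) K), Q.IsPrime ∧
      Q.height ≤ P.height + n ∧ ∀ j, pderiv j (∑ i, C (l i) * y i) ∈ Q := by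
  classical
  obtain ⟨c, ⟨i₀, hi₀⟩, hc⟩ := hd
  obtain ⟨s, hs, hcard⟩ := Ideal.exists_finset_card_eq_height_of_isNoetherianRing P
  obtain ⟨u, huP, hu⟩ := exists_mem_minimalPrimes_sep hs
  obtain ⟨x, hx, hxu⟩ := exists_point_of_not_mem hP (hP.mul_notMem hi₀ huP)
  rw [map_mul] at hxu
  have hb := left_ne_zero_of_mul hxu
  have hux := right_ne_zero_of_mul hxu
  let l : Fin n → K := fun i => eval x (c i) / eval x (c i₀)
  let t : Finset (MvPolynomial (Fin N) K) := s ∪ Finset.univ.image fun i => c i - C (l i) * c i₀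
  have hle : Ideal.span (t : Set (MvPolynomial (Fin N) K)) ≤ RingHom.ker (eval x) := by
    rw [Ideal.span_le]
    intro f hf
    rw [Finset.mem_coe, Finset.mem_union] at hf
    rcases hf with hf | hf
    · exact hx f (hs.1.2 (Ideal.subset_span hf))
    · obtain ⟨i, -, rfl⟩ := Finset.mem_image.1 hf
      change eval x _ = 0
      rw [map_sub, map_mul, eval_C, div_mul_cancel₀ _ hb, sub_self]
  have hker : (RingHom.ker (eval x)).IsPrime := RingHom.ker_isPrime _
  obtain ⟨Q, hQ, hQx⟩ := Ideal.exists_minimalPrimes_le hle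
  have hQp : Q.IsPrime := hQ.1.1
  refine ⟨l, ⟨i₀, by simp [l, hb]⟩, Q, hQp, ?_, fun j => ?_⟩
  · refine (Ideal.height_le_card_of_mem_minimalPrimes_span_finset hQ).trans ?_
    rw [← hcard]
    have h1 := Finset.card_union_le s (Finset.univ.image fun i => c i - C (l i) * c i₀)
    have h2 : (Finset.univ.image fun i => c i - C (l i) * c i₀).card ≤ n :=
      Finset.card_image_le.trans (by simp)
    exact_mod_cast h1.trans (by omega)
  · have hPQ : P ≤ Q := by
      have h1 : Ideal.span (s : Set (MvPolynomial (Fin N) K)) ≤ Q := by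
        refine le_trans (Ideal.span_mono ?_) hQ.1.2
        rw [Finset.coe_union]
        exact Set.subset_union_left
      obtain ⟨P', hP', hle'⟩ := Ideal.exists_minimalPrimes_le h1
      by_cases h : P' = P
      · exact h ▸ hle'
      · exact absurd (hQx (hle' (hu P' hP' h))) hux
    have hbQ : c i₀ ∉ Q := fun h => hb (hQx h)
    refine (hQp.mem_or_mem (x := c i₀) ?_).resolve_left hbQ
    have h1 : c i₀ * pderiv j (∑ i, C (l i) * y i) =
        ∑ i, c i * pderiv j (y i) - ∑ i, (c i - C (l i) * c i₀) * pderiv j (y i) := by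
      rw [map_sum, Finset.mul_sum, ← Finset.sum_sub_distrib]
      refine Finset.sum_congr rfl fun i _ => ?_
      rw [pderiv_C_mul]
      ring
    rw [h1]
    refine sub_mem (hPQ (hc j)) (sum_mem fun i _ => Ideal.mul_mem_right _ _ (hQ.1.2 (Ideal.subset_span ?_)))
    rw [Finset.coe_union]
    exact Or.inr (by simp)

theorem exists_mem_submodule_not_mem [Infinite K] {U : Submodule K (MvPolynomial (Fin N) K)}
    (S : Finset (Ideal (MvPolynomial (Fin N) K))) (h : ∀ P ∈ S, ∃ u ∈ U, u ∉ P) :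
    ∃ u ∈ U, ∀ P ∈ S, u ∉ P := by
  classical
  let T : Finset (Subspace K U) := S.image fun P => (P.restrictScalars K).comap U.subtype
  have h1 := Subspace.biUnion_ne_univ_of_top_notMem (s := T) (by
    intro htop
    obtain ⟨P, hP, hPt⟩ := Finset.mem_image.1 htop
    obtain ⟨u, hu, huP⟩ := h P hP
    have : (⟨u, hu⟩ : U) ∈ (P.restrictScalars K).comap U.subtype := hPt ▸ Submodule.mem_top
    exact huP this)
  obtain ⟨u, hu⟩ := (Set.ne_univ_iff_exists_notMem _).1 h1
  refine ⟨u, u.2, fun P hP huP => hu ?_⟩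
  rw [Set.mem_iUnion₂]
  exact ⟨_, Finset.mem_image_of_mem _ hP, huP⟩

theorem exists_generic_elements [Infinite K] (U : Submodule K (MvPolynomial (Fin N) K)) {H : ℕ}
    {Q : Ideal (MvPolynomial (Fin N) K)} (hQ : Q.IsPrime) (hUQ : ∀ u ∈ U, u ∈ Q) (hH : Q.height ≤ H) :
    ∃ k ≤ H, ∃ g : Fin k → MvPolynomial (Fin N) K, (∀ i, g i ∈ U) ∧
      ∃ Q' ∈ (Ideal.span (Set.range g)).minimalPrimes, ∀ u ∈ U, u ∈ Q' := by
  have hbd : ∀ k : ℕ, ∀ g : Fin k → MvPolynomial (Fin N) K, (∀ i, g i ∈ U) →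
      (∀ P : Ideal (MvPolynomial (Fin N) K), P.IsPrime → (∀ i, g i ∈ P) → (k : ℕ∞) ≤ P.height) → k ≤ H := by
    intro k g hg h
    exact_mod_cast (h Q hQ fun i => hUQ _ (hg i)).trans hH
  by_contra hcon
  push Not at hcon
  have key : ∀ k : ℕ, ∃ g : Fin k → MvPolynomial (Fin N) K, (∀ i, g i ∈ U) ∧
      ∀ P : Ideal (MvPolynomial (Fin N) K), P.IsPrime → (∀ i, g i ∈ P) → (k : ℕ∞) ≤ P.height := by
    intro k
    induction k with
    | zero => exact ⟨Fin.elim0, fun i => i.elim0, fun _ _ _ => by simp⟩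
    | succ k ih =>
      obtain ⟨g, hg, hht⟩ := ih
      have hk := hbd k g hg hht
      have hfin := (Ideal.span (Set.range g)).finite_minimalPrimes_of_isNoetherianRing
      obtain ⟨u, huU, hu⟩ := exists_mem_submodule_not_mem (U := U) hfin.toFinset (by
        intro P hP
        obtain ⟨u, hu, huP⟩ := hcon k hk g hg P (by simpa using hP)
        exact ⟨u, hu, huP⟩)
      refine ⟨Fin.snoc g u, fun i => ?_, fun P hP hgP => ?_⟩
      · refine Fin.lastCases ?_ (fun i => ?_) i
        · rwa [Fin.snoc_last]
        · rw [Fin.snoc_castSucc]; exact hg i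
      · have h1 : Ideal.span (Set.range g) ≤ P := by
          rw [Ideal.span_le]
          rintro _ ⟨i, rfl⟩
          have := hgP i.castSucc
          rwa [Fin.snoc_castSucc] at this
        have h2 := hgP (Fin.last k)
        rw [Fin.snoc_last] at h2
        obtain ⟨P', hP', hle⟩ := Ideal.exists_minimalPrimes_le h1
        have hP'p : P'.IsPrime := hP'.1.1
        have hlt : P' < P := lt_of_le_of_ne hle fun h => hu P' (by simpa using hP') (h ▸ h2)
        have h3 := Ideal.height_add_one_le_of_lt_of_isPrime hlt
        have h4 := hht P' hP'p fun i => hP'.1.2 (Ideal.subset_span ⟨i, rfl⟩)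
        refine le_trans ?_ h3
        push_cast
        gcongr
  obtain ⟨g, hg, hht⟩ := key (H + 1)
  have := hbd _ g hg hht
  omega

theorem homogeneousComponent_pderiv (k : ℕ) (j : Fin N) (f : MvPolynomial (Fin N) K) :
    homogeneousComponent k (pderiv j f) = pderiv j (homogeneousComponent (k + 1) f) := by
  conv_lhs => rw [← sum_homogeneousComponent f]
  rw [map_sum, map_sum]
  have h1 : ∀ i, homogeneousComponent k (pderiv j (homogeneousComponent i f)) =
      if i = k + 1 then pderiv j (homogeneousComponent (k + 1) f) else 0 := by
    intro i
    rcases i with _ | i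
    · rw [if_neg (by omega), homogeneousComponent_zero, pderiv_C, map_zero]
    · rw [homogeneousComponent_of_mem ((homogeneousComponent_isHomogeneous (i + 1) f).pderiv),
        Nat.add_sub_cancel]
      simp only [Nat.add_right_cancel_iff, eq_comm (a := k)]
      split_ifs with h
      · rw [h]
      · rfl
  rw [Finset.sum_congr rfl fun i _ => h1 i, Finset.sum_ite_eq']
  split_ifs with h
  · rfl
  · rw [homogeneousComponent_eq_zero _ _ (by simp at h; omega), map_zero]

end

/-- Every `s` forms of degrees in `[1, d]` lie in a subalgebra generated by at most `β s` forms of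
degrees in `[1, d]` that are smooth in codimension `η`. -/
def SmallSubalgebra (K : Type*) [Field K] (N η d : ℕ) (β : ℕ → ℕ) : Prop :=
  ∀ (s : ℕ) (f : Fin s → MvPolynomial (Fin N) K), (∀ i, ∃ e, 0 < e ∧ e ≤ d ∧ (f i).IsHomogeneous e) →
    ∃ n ≤ β s, ∃ y : Fin n → MvPolynomial (Fin N) K, (∀ i, ∃ e, 0 < e ∧ e ≤ d ∧ (y i).IsHomogeneous e) ∧
      SmoothSeq η y ∧ ∀ i, f i ∈ Algebra.adjoin K (Set.range y)

section

variable {K : Type*} [Field K] {N : ℕ}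

/-- A form all of whose partial derivatives lie in a smooth ideal is in a small algebra of forms of
smaller degree. -/
theorem exists_list_of_pderiv_mem [IsAlgClosed K] {η : ℕ} (hη : 2 ≤ η) {n : ℕ}
    {z : Fin n → MvPolynomial (Fin N) K} {e : ℕ}
    (hom : ∀ i, ∃ k, 0 < k ∧ k < e ∧ (z i).IsHomogeneous k) (hs : SmoothSeq η z)
    {F : MvPolynomial (Fin N) K} (he : 0 < e) (hFe : F.IsHomogeneous e)
    (hF : ∀ j, pderiv j F ∈ Ideal.span (Set.range z)) :
    ∃ L : List (ℕ × MvPolynomial (Fin N) K), L.length ≤ 2 * n + 1 ∧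
      (∀ p ∈ L, 0 < p.1 ∧ p.1 < e ∧ p.2.IsHomogeneous p.1) ∧
      F ∈ Algebra.adjoin K {f | ∃ p ∈ L, p.2 = f} := by
  have hom' : ∀ i, ∃ k, 0 < k ∧ (z i).IsHomogeneous k := fun i => by
    obtain ⟨k, h1, -, h2⟩ := hom i; exact ⟨k, h1, h2⟩
  rcases Nat.lt_or_ge e 2 with he2 | he2
  · obtain rfl : e = 1 := by omega
    refine ⟨[], by simp, by simp, ?_⟩
    have hn : n = 0 := by
      by_contra h
      obtain ⟨k, h1, h2, -⟩ := hom ⟨0, by omega⟩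
      omega
    subst hn
    have h0 : ∀ j, pderiv j F = 0 := fun j => by simpa using hF j
    have := hFe.sum_X_mul_pderiv
    simp only [h0, mul_zero, Finset.sum_const_zero, one_smul] at this
    rw [← this]
    exact zero_mem _
  obtain ⟨k, m, G, hm0, hme, hG, hFG⟩ := exists_isHomogeneous_pow_sub_mem hη hom' hs he2 hFe hF
  choose w hw0 hwe hw using hom
  obtain ⟨a, ha⟩ := Ideal.mem_span_range_iff_exists_fun.1 hFG
  refine ⟨(m, G) :: (List.ofFn (fun i => (w i, z i)) ++
    List.ofFn (fun i => (e - w i, homogeneousComponent (e - w i) (a i)))), ?_, ?_, ?_⟩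
  · simp; omega
  · intro p hp
    simp only [List.mem_cons, List.mem_append, List.mem_ofFn] at hp
    rcases hp with rfl | ⟨i, rfl⟩ | ⟨i, rfl⟩
    · exact ⟨hm0, hme, hG⟩
    · exact ⟨hw0 i, hwe i, hw i⟩
    · have := hw0 i
      have := hwe i
      exact ⟨by simp only; omega, by simp only; omega, homogeneousComponent_isHomogeneous _ _⟩
  · set A := Algebra.adjoin K {f | ∃ p ∈ (m, G) :: (List.ofFn (fun i => (w i, z i)) ++
      List.ofFn (fun i => (e - w i, homogeneousComponent (e - w i) (a i)))), p.2 = f} with hA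
    have hGA : G ∈ A := Algebra.subset_adjoin ⟨(m, G), by simp, rfl⟩
    have hzA : ∀ i, z i ∈ A := fun i => Algebra.subset_adjoin ⟨(w i, z i), by
      simp only [List.mem_cons, List.mem_append, List.mem_ofFn]; exact Or.inr (Or.inl ⟨i, rfl⟩), rfl⟩
    have haA : ∀ i, homogeneousComponent (e - w i) (a i) ∈ A := fun i =>
      Algebra.subset_adjoin ⟨(e - w i, homogeneousComponent (e - w i) (a i)), by
        simp only [List.mem_cons, List.mem_append, List.mem_ofFn]; exact Or.inr (Or.inr ⟨i, rfl⟩), rfl⟩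
    have h1 := congrArg (homogeneousComponent e) ha
    rw [map_sub, map_sum, homogeneousComponent_of_mem hFe, if_pos rfl,
      homogeneousComponent_of_mem (hG.pow (k + 1))] at h1
    rw [← sub_add_cancel F (if e = m * (k + 1) then G ^ (k + 1) else 0), ← h1]
    refine add_mem (sum_mem fun i _ => ?_) ?_
    · rw [homogeneousComponent_mul_of_isHomogeneous _ (hw i), if_pos (hwe i).le]
      exact mul_mem (haA i) (hzA i)
    · split_ifs
      · exact pow_mem hGA _
      · exact zero_mem _

/-- If `y` is not smooth, one of the `y i` can be traded for boundedly many forms of smaller degree. -/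
theorem exists_collapse [IsAlgClosed K] {η d : ℕ} (hη : 2 ≤ η) {β : ℕ → ℕ} (hβm : Monotone β)
    (hβ : ∀ e < d, SmallSubalgebra K N η e β) {n : ℕ} {y : Fin n → MvPolynomial (Fin N) K} {w : Fin n → ℕ}
    (hw0 : ∀ i, 0 < w i) (hwd : ∀ i, w i ≤ d) (hw : ∀ i, (y i).IsHomogeneous (w i))
    (hns : ¬ SmoothSeq η y) :
    ∃ i₀, ∃ L : List (ℕ × MvPolynomial (Fin N) K), L.length ≤ 2 * β ((2 * n + η) * (d - 1)) + 1 ∧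
      (∀ p ∈ L, 0 < p.1 ∧ p.1 < w i₀ ∧ p.2.IsHomogeneous p.1) ∧
      y i₀ ∈ Algebra.adjoin K ({f | ∃ p ∈ L, p.2 = f} ∪ y '' {i | i ≠ i₀}) := by
  classical
  have hinf : Infinite K := IsAlgClosed.instInfinite
  unfold SmoothSeq at hns
  push Not at hns
  obtain ⟨P, hP, hd, hht⟩ := hns
  obtain ⟨l, ⟨i₁, hi₁⟩, Q, hQ, hQht, hQF⟩ := hd.exists_scalars hP
  obtain ⟨i₀, hi₀, hmax⟩ := Finset.exists_max_image (Finset.univ.filter fun i => l i ≠ 0) w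
    ⟨i₁, by simpa using hi₁⟩
  rw [Finset.mem_filter] at hi₀
  replace hmax : ∀ i, l i ≠ 0 → w i ≤ w i₀ := fun i hi => hmax i (by simpa using hi)
  set F := ∑ i, C (l i) * y i with hF
  set e := w i₀ with he
  have hFk : ∀ k, homogeneousComponent k F = ∑ i, if w i = k then C (l i) * y i else 0 := by
    intro k
    rw [hF, map_sum]
    refine Finset.sum_congr rfl fun i _ => ?_
    rw [homogeneousComponent_C_mul, homogeneousComponent_of_mem (hw i)]
    simp only [eq_comm (a := k)]
    split_ifs <;> simp
  have hFtop : ∀ k, e < k → homogeneousComponent k F = 0 := by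
    intro k hk
    rw [hFk]
    refine Finset.sum_eq_zero fun i _ => ?_
    split_ifs with h
    · have : l i = 0 := by
        by_contra hl
        have := hmax i hl
        omega
      rw [this, C_0, zero_mul]
    · rfl
  let U : Submodule K (MvPolynomial (Fin N) K) := Submodule.span K (Set.range fun j => pderiv j F)
  have hUtop : ∀ u ∈ U, ∀ k, e ≤ k → homogeneousComponent k u = 0 := by
    intro u hu k hk
    have : U ≤ LinearMap.ker (homogeneousComponent k) := by
      rw [Submodule.span_le]
      rintro _ ⟨j, rfl⟩
      change homogeneousComponent k (pderiv j F) = 0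
      rw [homogeneousComponent_pderiv, hFtop _ (by omega), map_zero]
    exact this hu
  have hUQ : ∀ u ∈ U, u ∈ Q := by
    have : U ≤ Q.restrictScalars K := by
      rw [Submodule.span_le]
      rintro _ ⟨j, rfl⟩
      exact hQF j
    exact fun u hu => this hu
  obtain ⟨r, hr, g, hg, Q', hQ', hUQ'⟩ := exists_generic_elements U hQ hUQ (H := 2 * n + η) (by
    refine hQht.trans ((add_le_add_left hht _).trans ?_)
    exact_mod_cast (by omega))
  obtain ⟨B, hB, z, hz, hzs, hzg⟩ := hβ (e - 1) (by have := hw0 i₀; have := hwd i₀; omega)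
    (r * (e - 1)) (fun i => homogeneousComponent ((finProdFinEquiv.symm i).2 + 1) (g (finProdFinEquiv.symm i).1))
    (fun i => ⟨_, Nat.succ_pos _, (finProdFinEquiv.symm i).2.2, homogeneousComponent_isHomogeneous _ _⟩)
  have hz' : ∀ i, ∃ k, 0 < k ∧ (z i).IsHomogeneous k := fun i => by
    obtain ⟨k, h1, -, h2⟩ := hz i; exact ⟨k, h1, h2⟩
  obtain ⟨hzp, hzr⟩ := hzs.prime_and_regR hη hz'
  have hgA : ∀ f ∈ Set.range g, f ∈ Algebra.adjoin K (Set.range z) := by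
    rintro _ ⟨i, rfl⟩
    rw [← sum_homogeneousComponent (g i)]
    refine sum_mem fun k _ => ?_
    rcases k with _ | k
    · rw [homogeneousComponent_zero]
      exact Subalgebra.algebraMap_mem _ _
    · by_cases hk : k < e - 1
      · have := hzg (finProdFinEquiv (i, ⟨k, hk⟩))
        simpa only [Equiv.symm_apply_apply] using this
      · rw [hUtop _ (hg i) _ (by omega)]
        exact zero_mem _
  obtain ⟨a, ha⟩ := exists_le_span_sub_C hz' hzr hzp hgA hQ'
  have hpd : ∀ j, pderiv j (homogeneousComponent e F) ∈ Ideal.span (Set.range z) := by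
    intro j
    have h0 : 0 < e := hw0 i₀
    have hjU : pderiv j F ∈ U := Submodule.subset_span ⟨j, rfl⟩
    have h1 := homogeneousComponent_mem_span_of_deformation hz' hzr a (ha (hUQ' _ hjU)) (D := e - 1)
      (fun E hE => hUtop _ hjU E (by omega))
    rwa [homogeneousComponent_pderiv, Nat.sub_add_cancel h0] at h1
  obtain ⟨L, hL, hLp, hLF⟩ := exists_list_of_pderiv_mem (e := e) hη (fun i => by
      obtain ⟨k, h1, h2, h3⟩ := hz i; exact ⟨k, h1, by omega, h3⟩) hzs (hw0 i₀)
    (homogeneousComponent_isHomogeneous e F) hpd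
  refine ⟨i₀, L, ?_, hLp, ?_⟩
  · have h1 : r * (e - 1) ≤ (2 * n + η) * (d - 1) :=
      Nat.mul_le_mul hr (Nat.sub_le_sub_right (hwd i₀) 1)
    have h2 := hβm h1
    omega
  · set A := Algebra.adjoin K ({f | ∃ p ∈ L, p.2 = f} ∪ y '' {i | i ≠ i₀}) with hA
    have h1 : homogeneousComponent e F ∈ A := Algebra.adjoin_mono Set.subset_union_left hLF
    have h2 : ∀ i, i ≠ i₀ → y i ∈ A := fun i hi => Algebra.subset_adjoin (Or.inr ⟨i, hi, rfl⟩)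
    rw [hFk, ← Finset.add_sum_erase _ _ (Finset.mem_univ i₀), if_pos rfl] at h1
    have h3 : ∑ i ∈ Finset.univ.erase i₀, (if w i = e then C (l i) * y i else 0) ∈ A := by
      refine sum_mem fun i hi => ?_
      split_ifs
      · exact mul_mem (Subalgebra.algebraMap_mem A (l i)) (h2 i (Finset.ne_of_mem_erase hi))
      · exact zero_mem _
    have h4 := sub_mem h1 h3
    rw [add_sub_cancel_right] at h4
    have h5 := mul_mem (Subalgebra.algebraMap_mem A (l i₀)⁻¹) h4
    rwa [algebraMap_eq, ← mul_assoc, ← C_mul, inv_mul_cancel₀ hi₀.2, C_1, one_mul] at h5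

end

/-- The length reached after eliminating in turn all stages up to `k`, when a single step takes
length `s` to `φ s`. -/
def elimBound (φ : ℕ → ℕ) : ℕ → ℕ → ℕ
  | 0, s => s
  | k + 1, s => elimBound φ k ((φ ∘ elimBound φ k)^[s] s)

theorem elimBound_monotone_and_le {φ : ℕ → ℕ} (hm : Monotone φ) (hi : id ≤ φ) (k : ℕ) :
    Monotone (elimBound φ k) ∧ id ≤ elimBound φ k := by
  induction k with
  | zero => exact ⟨monotone_id, le_rfl⟩
  | succ k ih =>
    have hψm : Monotone (φ ∘ elimBound φ k) := hm.comp ih.1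
    have hψi : id ≤ φ ∘ elimBound φ k := fun s => (ih.2 s).trans (hi _)
    refine ⟨fun s t hst => ih.1 ?_, fun s => ?_⟩
    · exact (Function.monotone_iterate_of_id_le hψi hst s).trans (hψm.iterate t hst)
    · exact (Function.id_le_iterate_of_id_le hψi s s).trans (ih.2 _)

/-- Termination of a reduction process in which every step lowers one counter, keeps the higher
counters, and increases the length in a controlled way. -/
theorem exists_reduction {σ : Type*} (r : σ → σ → Prop) (hrefl : ∀ s, r s s)
    (htrans : ∀ s t u, r s t → r t u → r s u) (len : σ → ℕ) (cnt : ℕ → σ → ℕ)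
    (hcnt : ∀ j s, cnt j s ≤ len s) (S : σ → Prop) {φ : ℕ → ℕ} (hm : Monotone φ) (hi : id ≤ φ)
    (step : ∀ s, ¬ S s → ∃ e > 0, ∃ t, r s t ∧ len t ≤ φ (len s) ∧ cnt e t < cnt e s ∧
      ∀ j > e, cnt j t = cnt j s) (k : ℕ) (s : σ) :
    ∃ t, r s t ∧ len t ≤ elimBound φ k (len s) ∧ (∀ j > k, cnt j t = cnt j s) ∧
      (S t ∨ ∃ e > k, ∃ u, r t u ∧ len u ≤ φ (len t) ∧ cnt e u < cnt e t ∧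
        ∀ j > e, cnt j u = cnt j t) := by
  induction k generalizing s with
  | zero =>
    refine ⟨s, hrefl s, le_rfl, fun _ _ => rfl, ?_⟩
    by_cases h : S s
    · exact Or.inl h
    · exact Or.inr (step s h)
  | succ k ih =>
    obtain ⟨hΘm, hΘi⟩ := elimBound_monotone_and_le hm hi k
    have hψm : Monotone (φ ∘ elimBound φ k) := hm.comp hΘm
    have hψi : id ≤ φ ∘ elimBound φ k := fun s => (hΘi s).trans (hi _)
    suffices H : ∀ c s, cnt (k + 1) s ≤ c →
        ∃ t, r s t ∧ len t ≤ elimBound φ k ((φ ∘ elimBound φ k)^[c] (len s)) ∧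
        (∀ j > k + 1, cnt j t = cnt j s) ∧
        (S t ∨ ∃ e > k + 1, ∃ u, r t u ∧ len u ≤ φ (len t) ∧ cnt e u < cnt e t ∧
          ∀ j > e, cnt j u = cnt j t) from H (len s) s (hcnt _ _)
    intro c
    induction c with
    | zero =>
      intro s hs
      obtain ⟨t, h1, h2, h3, h4⟩ := ih s
      refine ⟨t, h1, h2, fun j hj => h3 j (by omega), ?_⟩
      rcases h4 with h4 | ⟨e, he, u, h5, h6, h7, h8⟩
      · exact Or.inl h4
      · rcases eq_or_lt_of_le (Nat.succ_le_of_lt he) with rfl | he'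
        · have := h3 (k + 1) (by omega)
          simp only [Nat.succ_eq_add_one] at h7
          omega
        · exact Or.inr ⟨e, he', u, h5, h6, h7, h8⟩
    | succ c ihc =>
      intro s hs
      obtain ⟨t, h1, h2, h3, h4⟩ := ih s
      have hlen : len t ≤ elimBound φ k ((φ ∘ elimBound φ k)^[c + 1] (len s)) :=
        h2.trans (hΘm (Function.id_le_iterate_of_id_le hψi _ _))
      rcases h4 with h4 | ⟨e, he, u, h5, h6, h7, h8⟩
      · exact ⟨t, h1, hlen, fun j hj => h3 j (by omega), Or.inl h4⟩
      · rcases eq_or_lt_of_le (Nat.succ_le_of_lt he) with rfl | he'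
        · have h9 := h3 (k + 1) (by omega)
          simp only [Nat.succ_eq_add_one] at h7 h8
          obtain ⟨v, g1, g2, g3, g4⟩ := ihc u (by omega)
          refine ⟨v, htrans _ _ _ h1 (htrans _ _ _ h5 g1), g2.trans (hΘm ?_), fun j hj => ?_, g4⟩
          · rw [Function.iterate_succ_apply]
            exact hψm.iterate c (h6.trans (hm h2))
          · rw [g3 j hj, h8 j hj, h3 j (by omega)]
        · exact ⟨t, h1, hlen, fun j hj => h3 j (by omega), Or.inr ⟨e, he', u, h5, h6, h7, h8⟩⟩

theorem countP_eraseIdx_add {α : Type*} (p : α → Bool) (l : List α) (i : Fin l.length) :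
    (l.eraseIdx i).countP p + (if p (l.get i) then 1 else 0) = l.countP p := by
  conv_rhs => rw [← List.take_append_drop i l, List.drop_eq_getElem_cons i.2]
  rw [List.eraseIdx_eq_take_drop_succ, List.countP_append, List.countP_append, List.countP_cons,
    List.get_eq_getElem, add_assoc]

section

variable {K : Type*} [Field K] {N : ℕ}

theorem SmallSubalgebra.elim [IsAlgClosed K] {η d : ℕ} (hη : 2 ≤ η) {β : ℕ → ℕ} (hβm : Monotone β)
    (hβ : ∀ e < d, SmallSubalgebra K N η e β) :
    SmallSubalgebra K N η d
      (elimBound (fun n => n + 2 * β ((2 * n + η) * (d - 1)) + 1) d) := by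
  intro s f hf
  choose v hv0 hvd hv using hf
  let R := MvPolynomial (Fin N) K
  let σ := {l : List (ℕ × R) // ∀ p ∈ l, 0 < p.1 ∧ p.1 ≤ d ∧ p.2.IsHomogeneous p.1}
  let alg : σ → Subalgebra K R := fun l => Algebra.adjoin K {f | ∃ p ∈ l.1, p.2 = f}
  have hm : Monotone (fun n => n + 2 * β ((2 * n + η) * (d - 1)) + 1) := by
    intro a b hab
    have : β ((2 * a + η) * (d - 1)) ≤ β ((2 * b + η) * (d - 1)) :=
      hβm (Nat.mul_le_mul_right _ (by omega))
    simp only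
    omega
  have hi : id ≤ (fun n => n + 2 * β ((2 * n + η) * (d - 1)) + 1) := fun n => by
    simp only [id]; omega
  have hstep : ∀ l : σ, ¬ SmoothSeq η (fun i => (l.1.get i).2) → ∃ e > 0, ∃ t : σ, alg l ≤ alg t ∧
      t.1.length ≤ (fun n => n + 2 * β ((2 * n + η) * (d - 1)) + 1) l.1.length ∧
      t.1.countP (fun p => p.1 = e) < l.1.countP (fun p => p.1 = e) ∧
      ∀ j > e, t.1.countP (fun p => p.1 = j) = l.1.countP (fun p => p.1 = j) := by
    rintro ⟨l, hl⟩ hns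
    obtain ⟨i₀, L, hL, hLp, hmem⟩ := exists_collapse (d := d) hη hβm hβ
      (w := fun i => (l.get i).1) (fun i => (hl _ (List.get_mem _ i)).1)
      (fun i => (hl _ (List.get_mem _ i)).2.1) (fun i => (hl _ (List.get_mem _ i)).2.2) hns
    have hlw := hl _ (List.get_mem l i₀)
    refine ⟨(l.get i₀).1, hlw.1, ⟨l.eraseIdx i₀ ++ L, ?_⟩, ?_, ?_, ?_, ?_⟩
    · intro p hp
      rcases List.mem_append.1 hp with hp | hp
      · exact hl p (List.mem_of_mem_eraseIdx hp)
      · obtain ⟨h1, h2, h3⟩ := hLp p hp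
        exact ⟨h1, h2.le.trans hlw.2.1, h3⟩
    · have hsub : ({f | ∃ p ∈ L, p.2 = f} ∪ (fun i => (l.get i).2) '' {i | i ≠ i₀}) ⊆
          {f | ∃ p ∈ l.eraseIdx i₀ ++ L, p.2 = f} := by
        rintro _ (⟨p, hp, rfl⟩ | ⟨i, hi, rfl⟩)
        · exact ⟨p, List.mem_append_right _ hp, rfl⟩
        · exact ⟨l.get i, List.mem_append_left _ (List.mem_eraseIdx_iff_getElem.2
            ⟨i, i.2, fun h => hi (Fin.ext h), rfl⟩), rfl⟩
      refine Algebra.adjoin_le ?_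
      rintro _ ⟨p, hp, rfl⟩
      obtain ⟨i, rfl⟩ := List.get_of_mem hp
      by_cases hi : i = i₀
      · subst hi
        exact Algebra.adjoin_mono hsub hmem
      · exact Algebra.subset_adjoin (hsub (Or.inr ⟨i, hi, rfl⟩))
    · simp only [List.length_append, List.length_eraseIdx]
      split_ifs <;> omega
    · have h1 := countP_eraseIdx_add (fun p : ℕ × R => decide (p.1 = (l.get i₀).1)) l i₀
      have h2 : L.countP (fun p : ℕ × R => decide (p.1 = (l.get i₀).1)) = 0 :=
        List.countP_eq_zero.2 fun p hp => by
          have := (hLp p hp).2.1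
          simp only [decide_eq_true_eq]
          omega
      rw [if_pos (by simp)] at h1
      have h3 := List.countP_append (p := fun p : ℕ × R => decide (p.1 = (l.get i₀).1)) (l₁ := l.eraseIdx i₀) (l₂ := L)
      rw [h2] at h3
      change (l.eraseIdx i₀ ++ L).countP (fun p : ℕ × R => decide (p.1 = (l.get i₀).1)) <
        l.countP (fun p : ℕ × R => decide (p.1 = (l.get i₀).1))
      omega
    · intro j hj
      have h1 := countP_eraseIdx_add (fun p : ℕ × R => decide (p.1 = j)) l i₀
      have h2 : L.countP (fun p : ℕ × R => decide (p.1 = j)) = 0 :=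
        List.countP_eq_zero.2 fun p hp => by
          have := (hLp p hp).2.1
          simp only [decide_eq_true_eq]
          omega
      rw [if_neg (by simpa using hj.ne)] at h1
      have h3 := List.countP_append (p := fun p : ℕ × R => decide (p.1 = j)) (l₁ := l.eraseIdx i₀) (l₂ := L)
      rw [h2] at h3
      change (l.eraseIdx i₀ ++ L).countP (fun p : ℕ × R => decide (p.1 = j)) =
        l.countP (fun p : ℕ × R => decide (p.1 = j))
      omega
  obtain ⟨t, h1, h2, -, h4⟩ := exists_reduction (σ := σ) (fun l l' => alg l ≤ alg l')
    (fun _ => le_rfl) (fun _ _ _ => le_trans) (fun l => l.1.length)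
    (fun j l => l.1.countP (fun p => p.1 = j)) (fun j l => List.countP_le_length)
    (fun l => SmoothSeq η (fun i => (l.1.get i).2)) hm hi hstep d
    ⟨List.ofFn (fun i => (v i, f i)), by
      intro p hp
      rw [List.mem_ofFn] at hp
      obtain ⟨i, rfl⟩ := hp
      exact ⟨hv0 i, hvd i, hv i⟩⟩
  have hS : SmoothSeq η (fun i => (t.1.get i).2) := by
    rcases h4 with h4 | ⟨e, he, u, -, -, h5, -⟩
    · exact h4
    · exfalso
      obtain ⟨p, hp, hpe⟩ := List.countP_pos_iff.1 (Nat.zero_lt_of_lt h5)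
      have := t.2 p hp
      simp only [decide_eq_true_eq] at hpe
      omega
  refine ⟨t.1.length, by simpa using h2, fun i => (t.1.get i).2, fun i =>
    ⟨_, t.2 _ (List.get_mem _ i)⟩, hS, fun i => ?_⟩
  have h5 : f i ∈ alg t := h1 (Algebra.subset_adjoin ⟨(v i, f i), by
    rw [List.mem_ofFn]; exact ⟨i, rfl⟩, rfl⟩)
  refine Algebra.adjoin_mono ?_ h5
  rintro _ ⟨p, hp, rfl⟩
  obtain ⟨i, rfl⟩ := List.get_of_mem hp
  exact ⟨i, rfl⟩

end

theorem knuth_one_left (a b : ℕ) : knuth a 1 b = a ^ b := by rw [knuth]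

theorem knuth_succ_zero (a m : ℕ) : knuth a (m + 1) 0 = 1 := by
  cases m <;> simp [knuth]

theorem knuth_succ_succ (a m b : ℕ) :
    knuth a (m + 2) (b + 1) = knuth a (m + 1) (knuth a (m + 2) b) := by
  cases b with
  | zero => cases m <;> simp [knuth]
  | succ b => rw [knuth]

theorem knuth_strictMono_and_lt {a : ℕ} (ha : 2 ≤ a) (m : ℕ) :
    StrictMono (knuth a (m + 1)) ∧ ∀ y, y < knuth a (m + 1) y := by
  induction m with
  | zero =>
    refine ⟨fun x y h => ?_, fun y => ?_⟩
    · rw [knuth_one_left, knuth_one_left]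
      exact Nat.pow_lt_pow_right (by omega) h
    · rw [knuth_one_left]
      exact Nat.lt_pow_self (by omega)
  | succ m ih =>
    have hs : StrictMono (knuth a (m + 2)) := strictMono_nat_of_lt_succ fun y => by
      rw [knuth_succ_succ]
      exact ih.2 _
    refine ⟨hs, fun y => ?_⟩
    induction y with
    | zero => rw [knuth_succ_zero]; exact one_pos
    | succ y ihy => exact (Nat.succ_le_of_lt ihy).trans_lt (hs (Nat.lt_succ_self y))

theorem knuth_strictMono {a : ℕ} (ha : 2 ≤ a) (m : ℕ) : StrictMono (knuth a (m + 1)) :=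
  (knuth_strictMono_and_lt ha m).1

theorem lt_knuth {a : ℕ} (ha : 2 ≤ a) (m y : ℕ) : y < knuth a (m + 1) y :=
  (knuth_strictMono_and_lt ha m).2 y

theorem knuth_monotone_left {a : ℕ} (ha : 2 ≤ a) (y : ℕ) : Monotone fun m => knuth a (m + 1) y := by
  refine monotone_nat_of_le_succ fun m => ?_
  cases y with
  | zero => rw [knuth_succ_zero, knuth_succ_zero]
  | succ y =>
    rw [knuth_succ_succ]
    exact (knuth_strictMono ha m).monotone (lt_knuth ha (m + 1) y)

theorem pow_le_knuth {a : ℕ} (ha : 2 ≤ a) (m y : ℕ) : a ^ y ≤ knuth a (m + 1) y := by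
  have := knuth_monotone_left ha y (Nat.zero_le m)
  simpa only [zero_add, knuth_one_left] using this

theorem mul_knuth_le {a : ℕ} (ha : 2 ≤ a) (m y : ℕ) :
    a * knuth a (m + 1) y ≤ knuth a (m + 1) (y + 1) := by
  cases m with
  | zero => rw [knuth_one_left, knuth_one_left, pow_succ']
  | succ m =>
    rw [knuth_succ_succ]
    refine le_trans ?_ (pow_le_knuth ha m _)
    obtain ⟨z, hz⟩ : ∃ z, knuth a (m + 2) y = z + 1 :=
      ⟨_, (Nat.succ_pred_eq_of_pos (Nat.zero_lt_of_lt (lt_knuth ha (m + 1) y))).symm⟩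
    rw [hz, pow_succ']
    exact Nat.mul_le_mul_left _ (Nat.lt_pow_self (by omega))

theorem add_two_le_pow {a y : ℕ} (ha : 3 ≤ a) (hy : 0 < y) : y + 2 ≤ a ^ y := by
  induction y, hy using Nat.le_induction with
  | base => simpa using ha
  | succ y hy ih => rw [pow_succ]; nlinarith

/-- A function bounded at one level moves the next Knuth function by three steps. -/
theorem apply_knuth_le {a m : ℕ} (ha : 3 ≤ a) {φ : ℕ → ℕ}
    (hφ : ∀ n, φ n ≤ knuth a (m + 1) (a ^ (n + 2))) (x : ℕ) :
    φ (knuth a (m + 2) x) ≤ knuth a (m + 2) (x + 3) := by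
  refine (hφ _).trans ?_
  rw [knuth_succ_succ a m (x + 2)]
  refine (knuth_strictMono (by omega) m).monotone ?_
  rw [knuth_succ_succ, knuth_succ_succ]
  refine le_trans ?_ (pow_le_knuth (by omega) m _)
  refine Nat.pow_le_pow_right (by omega) ?_
  exact (add_two_le_pow ha (Nat.zero_lt_of_lt (lt_knuth (by omega) (m + 1) x))).trans
    (pow_le_knuth (by omega) m _)

theorem elimBound_le_knuth {a m : ℕ} (ha : 3 ≤ a) {φ : ℕ → ℕ} (hm : Monotone φ) (hi : id ≤ φ)
    (hφ : ∀ n, φ n ≤ knuth a (m + 1) (a ^ (n + 2))) (k n : ℕ) :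
    elimBound φ k n ≤ knuth a (m + k + 1) (a ^ (n + 2)) := by
  have ha2 : 2 ≤ a := by omega
  induction k generalizing n with
  | zero =>
    rw [elimBound]
    have h1 : n < a ^ n := Nat.lt_pow_self (by omega)
    have h2 : a ^ n ≤ a ^ (n + 2) := Nat.pow_le_pow_right (by omega) (by omega)
    have h3 := lt_knuth ha2 (m + 0) (a ^ (n + 2))
    omega
  | succ k ih =>
    obtain ⟨hΘm, hΘi⟩ := elimBound_monotone_and_le hm hi k
    have hφ' : ∀ n, φ n ≤ knuth a (m + k + 1) (a ^ (n + 2)) := fun n =>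
      (hφ n).trans (knuth_monotone_left ha2 _ (Nat.le_add_right m k))
    have hψ : ∀ j, (φ ∘ elimBound φ k)^[j] n ≤ knuth a (m + k + 2) (n + 6 * j) := by
      intro j
      induction j with
      | zero => exact (lt_knuth ha2 (m + k + 1) n).le
      | succ j ihj =>
        rw [Function.iterate_succ_apply']
        exact (hm ((hΘm ihj).trans (apply_knuth_le ha ih _))).trans (apply_knuth_le ha hφ' _)
    rw [elimBound]
    refine ((hΘm (hψ n)).trans (apply_knuth_le ha ih _)).trans ?_
    refine (knuth_strictMono ha2 (m + k + 1)).monotone ?_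
    have h1 : 7 * n + 9 ≤ 3 ^ (n + 2) := by
      clear hψ
      induction n with
      | zero => norm_num
      | succ n ihn => rw [pow_succ]; omega
    have h2 : 3 ^ (n + 2) ≤ a ^ (n + 2) := Nat.pow_le_pow_left ha _
    omega

/-- The bound for a single elimination step is one level above the bound in lower degree. -/
theorem step_le_knuth {a m d η : ℕ} (ha : 3 ≤ a) (hd2 : 2 ≤ d) (hd : d ≤ a) (hη : η ≤ a + 1) (n : ℕ) :
    n + 2 * knuth a (m + 1) (a ^ ((2 * n + η) * (d - 1) + 2)) + 1 ≤
      knuth a (m + 2) (a ^ (n + 2)) := by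
  have ha2 : 2 ≤ a := by omega
  have hX : (2 * n + η) * (d - 1) ≤ (2 * n + a + 1) * (a - 1) :=
    Nat.mul_le_mul (by omega) (by omega)
  set X := (2 * n + η) * (d - 1) with hXdef
  have hXn : X + 3 ≤ a ^ (n + 5) := by
    obtain ⟨b, rfl⟩ : ∃ b, a = b + 1 := ⟨a - 1, by omega⟩
    rw [Nat.add_sub_cancel] at hX
    have h1 : n + 3 < (b + 1) ^ (n + 3) := Nat.lt_pow_self (by omega)
    have h2 : (b + 1) ^ (n + 5) = (b + 1) ^ (n + 3) * ((b + 1) * (b + 1)) := by ring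
    rw [h2]
    have h3 := Nat.mul_le_mul_right ((b + 1) * (b + 1)) (Nat.succ_le_of_lt h1)
    refine le_trans (Nat.add_le_add_right hX 3) (le_trans ?_ h3)
    nlinarith [Nat.zero_le (n * b * b)]
  obtain ⟨t, ht⟩ : ∃ t, a ^ (n + 2) = t + 2 ∧ n + 5 ≤ t := by
    have h1 : 9 * (n + 1) ≤ a ^ (n + 2) := by
      have h2 : n < 3 ^ n := Nat.lt_pow_self (by omega)
      have h3 : 3 ^ (n + 2) ≤ a ^ (n + 2) := Nat.pow_le_pow_left ha _
      rw [pow_add] at h3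
      omega
    exact ⟨a ^ (n + 2) - 2, by omega, by omega⟩
  have h1 : a ^ (X + 3) ≤ knuth a (m + 2) (t + 1) := by
    rw [knuth_succ_succ]
    refine le_trans (Nat.pow_le_pow_right (by omega) ?_) (pow_le_knuth ha2 m _)
    exact (hXn.trans (Nat.pow_le_pow_right (by omega) ht.2)).trans (pow_le_knuth ha2 (m + 1) _)
  have hn : n + 1 ≤ knuth a (m + 1) (a ^ (X + 2)) := by
    have h2 : (2 * n + η) * 1 ≤ X := Nat.mul_le_mul_left _ (by omega)
    have h3 : X + 2 < a ^ (X + 2) := Nat.lt_pow_self (by omega)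
    have h4 := lt_knuth ha2 m (a ^ (X + 2))
    omega
  calc n + 2 * knuth a (m + 1) (a ^ (X + 2)) + 1 ≤ a * knuth a (m + 1) (a ^ (X + 2)) := by nlinarith
    _ ≤ knuth a (m + 1) (a ^ (X + 2) + 1) := mul_knuth_le ha2 _ _
    _ ≤ knuth a (m + 1) (a ^ (X + 3)) := (knuth_strictMono ha2 m).monotone
        (Nat.pow_lt_pow_right (by omega) (by omega))
    _ ≤ knuth a (m + 1) (knuth a (m + 2) (t + 1)) := (knuth_strictMono ha2 m).monotone h1
    _ = knuth a (m + 2) (a ^ (n + 2)) := by rw [ht.1, ← knuth_succ_succ]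

theorem knuth_pow_add_two_le {a m s : ℕ} (ha : 3 ≤ a) (hs : 0 < s) :
    knuth a (m + 1) (a ^ (s + 2)) ≤ knuth a (m + 2) (a ^ s) := by
  have ha2 : 2 ≤ a := by omega
  have h1 := add_two_le_pow ha hs
  obtain ⟨t, ht⟩ : ∃ t, a ^ s = t + 2 := ⟨a ^ s - 2, by omega⟩
  rw [ht, knuth_succ_succ, knuth_succ_succ]
  refine (knuth_strictMono ha2 m).monotone ((Nat.pow_le_pow_right (by omega) ?_).trans
    (pow_le_knuth ha2 m _))
  refine le_trans ?_ (pow_le_knuth ha2 (m + 1) _)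
  refine h1.trans (Nat.pow_le_pow_right (by omega) (by omega))

section

variable {K : Type*} [Field K] {N : ℕ}

theorem SmallSubalgebra.mono {η d : ℕ} {β β' : ℕ → ℕ} (h : SmallSubalgebra K N η d β)
    (hβ : β ≤ β') : SmallSubalgebra K N η d β' := fun s f hf => by
  obtain ⟨n, hn, r⟩ := h s f hf
  exact ⟨n, hn.trans (hβ s), r⟩

theorem smallSubalgebra_zero (η : ℕ) : SmallSubalgebra K N η 0 fun _ => 0 := by
  intro s f hf
  refine ⟨0, le_rfl, fun i => i.elim0, fun i => i.elim0, ?_, fun i => ?_⟩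
  · rintro P - ⟨-, ⟨i, -⟩, -⟩
    exact i.elim0
  · obtain ⟨e, h1, h2, -⟩ := hf i
    omega

theorem smallSubalgebra_knuth [IsAlgClosed K] {η a : ℕ} (hη : 2 ≤ η) (ha : 3 ≤ a)
    (hηa : η ≤ a + 1) (d : ℕ) (hd : d ≤ a) :
    SmallSubalgebra K N η d fun n => knuth a (d ^ 2 + d - 3 + 1) (a ^ (n + 2)) := by
  have ha2 : 2 ≤ a := by omega
  induction d using Nat.strong_induction_on with
  | _ d ih =>
    rcases Nat.lt_or_ge d 2 with hd2 | hd2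
    · interval_cases d
      · exact (smallSubalgebra_zero η).mono fun _ => Nat.zero_le _
      · refine (SmallSubalgebra.elim hη (β := fun _ => 0) monotone_const
          (fun e he => ?_)).mono fun n => ?_
        · obtain rfl : e = 0 := by omega
          exact smallSubalgebra_zero η
        · have h1 : ∀ k, (fun n : ℕ => n + 1)^[k] n = n + k := fun k => by
            induction k with
            | zero => rfl
            | succ k ihk => rw [Function.iterate_succ_apply', ihk, add_assoc]
          have h2 : n < a ^ n := Nat.lt_pow_self (by omega)
          have h3 : a ^ n * 3 ≤ a ^ (n + 1) := by
            rw [pow_succ]; exact Nat.mul_le_mul_left _ ha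
          have h4 := lt_knuth ha2 0 (a ^ (n + 2))
          have h5 : a ^ (n + 1) ≤ a ^ (n + 2) := Nat.pow_le_pow_right (by omega) (by omega)
          change (fun n : ℕ => n + 1)^[n] n ≤ knuth a 1 (a ^ (n + 2))
          rw [h1]
          simp only [zero_add] at h4
          omega
    · have hmon : Monotone fun n => knuth a ((d - 1) ^ 2 + (d - 1) - 3 + 1) (a ^ (n + 2)) :=
        fun x y hxy => (knuth_strictMono ha2 _).monotone
          (Nat.pow_le_pow_right (by omega) (by omega))
      refine (SmallSubalgebra.elim hη hmon (fun e he => (ih e he (by omega)).mono fun n => ?_)).mono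
        fun n => ?_
      · refine knuth_monotone_left ha2 _ ?_
        have : e ^ 2 ≤ (d - 1) ^ 2 := Nat.pow_le_pow_left (by omega) 2
        omega
      · refine (elimBound_le_knuth ha (m := (d - 1) ^ 2 + (d - 1) - 3 + 1) ?_ ?_
          (step_le_knuth ha hd2 hd hηa) d n).trans (knuth_monotone_left ha2 _ ?_)
        · intro x y hxy
          have h1 := hmon (Nat.mul_le_mul_right (d - 1)
            (Nat.add_le_add_right (Nat.mul_le_mul_left 2 hxy) η))
          simp only at h1 ⊢
          omega
        · intro x
          simp only [id]
          omega
        · obtain ⟨c, rfl⟩ : ∃ c, d = c + 2 := ⟨d - 2, by omega⟩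
          have h1 : (c + 2) ^ 2 = c ^ 2 + 4 * c + 4 := by ring
          have h2 : (c + 2 - 1) ^ 2 = c ^ 2 + 2 * c + 1 := by
            rw [show c + 2 - 1 = c + 1 by omega]; ring
          rw [h1, h2]
          omega

end

section

variable {K : Type*} [Field K] {N : ℕ}

theorem SmoothSeq.serreReg {η n : ℕ} {y : Fin n → MvPolynomial (Fin N) K} (hs : SmoothSeq η y) :
    SerreReg η (MvPolynomial (Fin N) K ⧸ Ideal.span (Set.range y)) := by
  intro p hp
  refine isRegularLocal_of_not_dep p.asIdeal fun hd => ?_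
  have h1 := hs _ inferInstance hd
  have h2 := height_comap_mk_le p.asIdeal
  rw [PrimeSpectrum.height_eq_orderHeight] at h2
  refine absurd (h1.trans_le (h2.trans (add_le_add_left hp _))) ?_
  push_cast
  rw [add_comm]
  exact lt_irrefl _

theorem SmoothSeq.isSerreSeq {η n : ℕ} (hη : 2 ≤ η) {y : Fin n → MvPolynomial (Fin N) K}
    (hom : ∀ i, ∃ e, 0 < e ∧ (y i).IsHomogeneous e) (hs : SmoothSeq η y) : IsSerreSeq η y := by
  refine ⟨(hs.prime_and_regR hη hom).1.ne_top, fun m hm => ?_⟩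
  have h1 : y '' {j : Fin n | (j : ℕ) < m} = Set.range (y ∘ Fin.castLE hm) := by
    rw [Set.range_comp]
    congr 1
    ext j
    exact ⟨fun hj => ⟨⟨j, hj⟩, rfl⟩, by rintro ⟨i, rfl⟩; exact i.2⟩
  rw [h1]
  exact (hs.comp (Fin.castLE_injective hm)).serreReg

theorem finiteDimensional_of_forall_isHomogeneous {n : ℕ} (V : Submodule K (MvPolynomial (Fin N) K))
    (hV : ∀ f ∈ V, f.IsHomogeneous n) : FiniteDimensional K V := by
  have h : V ≤ restrictTotalDegree (Fin N) K n := fun f hf =>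
    (mem_restrictTotalDegree (Fin N) n f).2 (hV f hf).totalDegree_le
  exact Submodule.finiteDimensional_of_le h

end

/-- Small subalgebra bound for `R_η`, `η ≥ 4`: with `d₁ = max{d, η-1}` and
`B_d(η,δ) = d₁ ↑^(d²+d-1) (d₁^{|δ|})`, every graded vector space `V = ⊕_{i=1}^d V_i`
of forms with dimension vector `δ` is contained in a `K`-subalgebra generated by an
`R_η`-sequence of forms of degrees at most `d` and length at most `B_d(η,δ)`. -/
theorem small_subalgebra_Reta {K : Type*} [Field K] [IsAlgClosed K] {N : ℕ}
    (d η : ℕ) (hd : 2 ≤ d) (hη : 4 ≤ η) (δ : Fin d → ℕ)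
    (V : Fin d → Submodule K (MvPolynomial (Fin N) K))
    (hVhom : ∀ i : Fin d, ∀ f ∈ V i, f.IsHomogeneous ((i : ℕ) + 1))
    (hVdim : ∀ i : Fin d, Module.finrank K (V i) = δ i)
    (d₁ : ℕ) (hd₁ : d₁ = max d (η - 1)) :
    ∃ n : ℕ, n ≤ knuth d₁ (d ^ 2 + d - 1) (d₁ ^ (∑ i, δ i)) ∧
      ∃ y : Fin n → MvPolynomial (Fin N) K,
        (∀ j, ∃ e : ℕ, 0 < e ∧ e ≤ d ∧ (y j).IsHomogeneous e) ∧
        IsSerreSeq η y ∧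
        ∀ i : Fin d, (V i : Set (MvPolynomial (Fin N) K)) ⊆
          (Algebra.adjoin K (Set.range y) : Subalgebra K (MvPolynomial (Fin N) K)) := by
  have hfin : ∀ i, FiniteDimensional K (V i) := fun i =>
    finiteDimensional_of_forall_isHomogeneous _ (hVhom i)
  let b : ∀ i, Module.Basis (Fin (δ i)) K (V i) := fun i => Module.finBasisOfFinrankEq K (V i) (hVdim i)
  let f : Fin (∑ i, δ i) → MvPolynomial (Fin N) K := fun k =>
    (b (finSigmaFinEquiv.symm k).1 (finSigmaFinEquiv.symm k).2 : MvPolynomial (Fin N) K)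
  have hf : ∀ k, ∃ e, 0 < e ∧ e ≤ d ∧ (f k).IsHomogeneous e := fun k =>
    ⟨_, Nat.succ_pos _, (finSigmaFinEquiv.symm k).1.2, hVhom _ _ (Subtype.mem _)⟩
  have key : ∃ n ≤ knuth d₁ (d ^ 2 + d - 1) (d₁ ^ (∑ i, δ i)),
      ∃ y : Fin n → MvPolynomial (Fin N) K, (∀ i, ∃ e, 0 < e ∧ e ≤ d ∧ (y i).IsHomogeneous e) ∧
      SmoothSeq η y ∧ ∀ i, f i ∈ Algebra.adjoin K (Set.range y) := by
    rcases Nat.eq_zero_or_pos (∑ i, δ i) with h0 | hpos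
    · obtain ⟨n, hn, y, hy, hs, -⟩ := smallSubalgebra_zero (K := K) (N := N) η 0 Fin.elim0
        fun i => i.elim0
      refine ⟨n, hn.trans (Nat.zero_le _), y, fun i => ?_, hs, fun i => ?_⟩
      · obtain ⟨e, h1, h2, -⟩ := hy i
        omega
      · exact absurd i.2 (by omega)
    · have ha : 3 ≤ d₁ := by omega
      obtain ⟨n, hn, r⟩ := smallSubalgebra_knuth (K := K) (N := N) (η := η) (by omega) ha
        (by omega) d (by omega) _ f hf
      refine ⟨n, hn.trans ((knuth_pow_add_two_le ha hpos).trans (le_of_eq ?_)), r⟩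
      congr 1
      have : 2 ^ 2 ≤ d ^ 2 := Nat.pow_le_pow_left hd 2
      omega
  obtain ⟨n, hn, y, hy, hs, hfy⟩ := key
  refine ⟨n, hn, y, hy, hs.isSerreSeq (by omega) fun i => ?_, fun i g hg => ?_⟩
  · obtain ⟨e, h1, -, h2⟩ := hy i
    exact ⟨e, h1, h2⟩
  · have h1 : g = ∑ k, (b i).repr ⟨g, hg⟩ k • (b i k : MvPolynomial (Fin N) K) := by
      have := congrArg Subtype.val ((b i).sum_repr ⟨g, hg⟩)
      rw [AddSubmonoidClass.coe_finsetSum] at this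
      exact this.symm
    rw [SetLike.mem_coe, h1]
    refine sum_mem fun k _ => Subalgebra.smul_mem _ ?_ _
    have h2 := hfy (finSigmaFinEquiv ⟨i, k⟩)
    simp only [f] at h2
    rwa [Equiv.symm_apply_apply] at h2
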